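/- arXiv:1312.0021 — 2 statements merged into one kernel-verified Lean document; each statement's English description precedes it below -/
import Mathlib

section
/- Fix integers l ≥ 1 and e ≥ 2, let s ∈ S_e and let (λ,s) be cylindric but not FLOTW, with first pseudoperiod P(λ). Let B be the set of entries of the s-symbol B_s(λ) corresponding to the e nodes of P(λ). Then each column of B_s(λ) contains at most one element of B, and the elements of B appear in e consecutive columns of B_s(λ). -/
namespace FockCrystal

/-- A partition: `part a` is the `a`-th part, for `a ≥ 1`; `part 0` is a dummy value `0`. -/
structure Partition where
  part : ℕ → ℕ
  part_zero : part 0 = 0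
  antitone : ∀ a : ℕ, 1 ≤ a → part (a + 1) ≤ part a
  eventually_zero : ∃ N : ℕ, ∀ a : ℕ, N ≤ a → part a = 0

/-- A multipartition with `l + 1` components. -/
abbrev MultiPartition (l : ℕ) := Fin (l + 1) → Partition

/-- A node `(a, b, c)`: row `a ≥ 1`, column `b ≥ 1`, component `c`. -/
structure Node (l : ℕ) where
  row : ℕ
  col : ℕ
  comp : Fin (l + 1)

variable {l : ℕ}

def IsNode (Λ : MultiPartition l) (γ : Node l) : Prop :=
  1 ≤ γ.row ∧ 1 ≤ γ.col ∧ γ.col ≤ (Λ γ.comp).part γ.row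

/-- The content `b − a + s_c` of a node. -/
def content (s : Fin (l + 1) → ℤ) (γ : Node l) : ℤ :=
  (γ.col : ℤ) - (γ.row : ℤ) + s γ.comp

/-- `γ` is a removable node of `Λ`. -/
def Removable (Λ : MultiPartition l) (γ : Node l) : Prop :=
  1 ≤ γ.row ∧ 1 ≤ γ.col ∧ γ.col = (Λ γ.comp).part γ.row ∧
    (Λ γ.comp).part (γ.row + 1) < (Λ γ.comp).part γ.row

/-- `γ` is an addable node of `Λ`. -/
def Addable (Λ : MultiPartition l) (γ : Node l) : Prop :=
  1 ≤ γ.row ∧ γ.col = (Λ γ.comp).part γ.row + 1 ∧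
    (γ.row = 1 ∨ (Λ γ.comp).part γ.row < (Λ γ.comp).part (γ.row - 1))

/-- The strict order `≺_s` on nodes. -/
def NodeLt (s : Fin (l + 1) → ℤ) (γ γ' : Node l) : Prop :=
  content s γ < content s γ' ∨ (content s γ = content s γ' ∧ γ'.comp < γ.comp)

inductive Letter | A | R
  deriving DecidableEq

/-- The letter attached to a node is `A` iff the node is addable, `R` iff removable. -/
def LetterOk (Λ : MultiPartition l) (p : Node l × Letter) : Prop :=
  (p.2 = Letter.A ↔ Addable Λ p.1) ∧ (p.2 = Letter.R ↔ Removable Λ p.1)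

/-- `w` is the `i`-word of `(Λ, s)` for the residue-mod-`e` structure: the list of
addable/removable nodes of residue `i`, in increasing `≺_s`-order, with letters A/R. -/
def IsWordE (Λ : MultiPartition l) (s : Fin (l + 1) → ℤ) (e : ℕ) (i : ℤ)
    (w : List (Node l × Letter)) : Prop :=
  w.Pairwise (fun p q => NodeLt s p.1 q.1) ∧
  (∀ γ : Node l, (∃ x, (γ, x) ∈ w) ↔
      ((Addable Λ γ ∨ Removable Λ γ) ∧ content s γ % (e : ℤ) = i)) ∧
  ∀ p ∈ w, LetterOk Λ p

/-- `w` is the `j`-word of `(Λ, s)` for the `e = ∞` structure: the list of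
addable/removable nodes of content `j`, in increasing `≺_s`-order, with letters A/R. -/
def IsWordInf (Λ : MultiPartition l) (s : Fin (l + 1) → ℤ) (j : ℤ)
    (w : List (Node l × Letter)) : Prop :=
  w.Pairwise (fun p q => NodeLt s p.1 q.1) ∧
  (∀ γ : Node l, (∃ x, (γ, x) ∈ w) ↔
      ((Addable Λ γ ∨ Removable Λ γ) ∧ content s γ = j)) ∧
  ∀ p ∈ w, LetterOk Λ p

/-- Recursive cancellation of all factors `RA` in a word (of nodes with letters). -/
def reduceW : List (Node l × Letter) → List (Node l × Letter)
  | [] => []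
  | p :: ps =>
    match reduceW ps with
    | [] => [p]
    | q :: qs => if p.2 = Letter.R ∧ q.2 = Letter.A then qs else p :: q :: qs

/-- `γ` is the node encoded by the rightmost `A` of the reduced word of `w`. -/
def GoodAddableWord (w : List (Node l × Letter)) (γ : Node l) : Prop :=
  ∃ u v, reduceW w = u ++ (γ, Letter.A) :: v ∧ ∀ p ∈ v, p.2 = Letter.R

/-- `γ` is the node encoded by the leftmost `R` of the reduced word of `w`. -/
def GoodRemovableWord (w : List (Node l × Letter)) (γ : Node l) : Prop :=
  ∃ u v, reduceW w = u ++ (γ, Letter.R) :: v ∧ ∀ p ∈ u, p.2 = Letter.A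

/-- `γ` is the good addable `i`-node of `(Λ, s)` for the residue-mod-`e` structure. -/
def GoodAddable (Λ : MultiPartition l) (s : Fin (l + 1) → ℤ) (e : ℕ) (i : ℤ)
    (γ : Node l) : Prop :=
  ∃ w, IsWordE Λ s e i w ∧ GoodAddableWord w γ

/-- `γ` is the good removable `i`-node of `(Λ, s)` for the residue-mod-`e` structure. -/
def GoodRemovable (Λ : MultiPartition l) (s : Fin (l + 1) → ℤ) (e : ℕ) (i : ℤ)
    (γ : Node l) : Prop :=
  ∃ w, IsWordE Λ s e i w ∧ GoodRemovableWord w γ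

/-- `γ` is the good addable `j`-node of `(Λ, s)` for the `e = ∞` structure. -/
def GoodAddableInf (Λ : MultiPartition l) (s : Fin (l + 1) → ℤ) (j : ℤ)
    (γ : Node l) : Prop :=
  ∃ w, IsWordInf Λ s j w ∧ GoodAddableWord w γ

/-- `Λ'` is obtained from `Λ` by adding the node `γ`. -/
def AddNode (Λ Λ' : MultiPartition l) (γ : Node l) : Prop :=
  (Λ' γ.comp).part γ.row = (Λ γ.comp).part γ.row + 1 ∧
  (∀ a : ℕ, a ≠ γ.row → (Λ' γ.comp).part a = (Λ γ.comp).part a) ∧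
  ∀ c, c ≠ γ.comp → Λ' c = Λ c

/-- `s ∈ S_e`: `0 ≤ s_c − s_{c'} < e` whenever `c' < c`. -/
def InSe (e : ℕ) (s : Fin (l + 1) → ℤ) : Prop :=
  ∀ c' c : Fin (l + 1), c' < c → 0 ≤ s c - s c' ∧ s c - s c' < (e : ℤ)

/-- `s ∈ D_e`: `0 ≤ s_1 ≤ … ≤ s_l < e`. -/
def InDe (e : ℕ) (s : Fin (l + 1) → ℤ) : Prop :=
  (∀ c, 0 ≤ s c ∧ s c < (e : ℤ)) ∧ Monotone s

/-- The rotation `c ↦ c + 1` of components. -/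
def rho (l : ℕ) : Equiv.Perm (Fin (l + 1)) := finRotate (l + 1)

/-- The cyclage on multicharges: `ξ(s) = (s_l − e, s_1, …, s_{l−1})`. -/
def xiCharge (e : ℕ) (s : Fin (l + 1) → ℤ) : Fin (l + 1) → ℤ :=
  fun c => s ((rho l).symm c) - if c = 0 then (e : ℤ) else 0

/-- The cyclage on multipartitions: `ξ(λ) = (λ^l, λ^1, …, λ^{l−1})`. -/
def xiMP (Λ : MultiPartition l) : MultiPartition l := fun c => Λ ((rho l).symm c)

/-- The corresponding bijection on nodes: `(a,b,c) ↦ (a,b,c+1)` cyclically. -/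
def xiNode (γ : Node l) : Node l := ⟨γ.row, γ.col, rho l γ.comp⟩

/-- The component preceding `c` (cyclically). -/
def prevComp {l : ℕ} (c : Fin (l + 1)) : Fin (l + 1) := (rho l).symm c

/-- `(Λ, s)` is cylindric. -/
def Cylindric (e : ℕ) (s : Fin (l + 1) → ℤ) (Λ : MultiPartition l) : Prop :=
  (∀ c : Fin l, ∀ a : ℕ, 1 ≤ a →
      (Λ c.succ).part (a + (s c.succ - s c.castSucc).toNat) ≤ (Λ c.castSucc).part a) ∧
  ∀ a : ℕ, 1 ≤ a →
      (Λ 0).part (a + ((e : ℤ) + s 0 - s (Fin.last l)).toNat) ≤ (Λ (Fin.last l)).part a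

/-- `γ` is the rightmost node of a part of `Λ` of size `α`. -/
def RightmostAt (Λ : MultiPartition l) (α : ℕ) (γ : Node l) : Prop :=
  1 ≤ γ.row ∧ γ.col = α ∧ (Λ γ.comp).part γ.row = α

/-- The residues of the rightmost nodes of the parts of size `α` cover `{0,…,e−1}`. -/
def Covers (e : ℕ) (s : Fin (l + 1) → ℤ) (Λ : MultiPartition l) (α : ℕ) : Prop :=
  ∀ r : ℤ, 0 ≤ r → r < (e : ℤ) →
    ∃ γ : Node l, RightmostAt Λ α γ ∧ content s γ % (e : ℤ) = r

/-- `(Λ, s)` is FLOTW. -/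
def FLOTW (e : ℕ) (s : Fin (l + 1) → ℤ) (Λ : MultiPartition l) : Prop :=
  Cylindric e s Λ ∧ ∀ α : ℕ, 1 ≤ α → ¬ Covers e s Λ α

/-- `P 0, …, P (e−1)` is the first pseudoperiod of `(Λ, s)`, of width `α`. -/
def IsFirstPseudoperiod (e : ℕ) (s : Fin (l + 1) → ℤ) (Λ : MultiPartition l)
    (α : ℕ) (P : ℕ → Node l) : Prop :=
  1 ≤ α ∧ Covers e s Λ α ∧ (∀ β : ℕ, α < β → ¬ Covers e s Λ β) ∧
  (∀ i, i < e → RightmostAt Λ α (P i)) ∧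
  (∀ γ, RightmostAt Λ α γ → content s γ ≤ content s (P 0)) ∧
  (∀ γ, RightmostAt Λ α γ → content s γ = content s (P 0) → (P 0).comp ≤ γ.comp) ∧
  ∀ i : ℕ, i + 1 < e →
    content s (P (i + 1)) < content s (P i) ∧
    (∀ γ, RightmostAt Λ α γ → content s γ < content s (P i) →
        content s γ ≤ content s (P (i + 1))) ∧
    ∀ γ, RightmostAt Λ α γ → content s γ = content s (P (i + 1)) →
        (P (i + 1)).comp ≤ γ.comp

/-- `γ` is one of the nodes of the pseudoperiod `P` (of length `e`). -/
def InPseudo (e : ℕ) (P : ℕ → Node l) (γ : Node l) : Prop := ∃ i, i < e ∧ P i = γ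

/-- The number of parts of `π` equal to `v`. -/
noncomputable def countParts (π : Partition) (v : ℕ) : ℕ :=
  Nat.card {a : ℕ // 1 ≤ a ∧ π.part a = v}

/-- `N^{>α}_c`: the number of parts of `Λ^c` greater than `α`. -/
noncomputable def NgtA (Λ : MultiPartition l) (α : ℕ) (c : Fin (l + 1)) : ℕ :=
  Nat.card {a : ℕ // 1 ≤ a ∧ α < (Λ c).part a}

/-- `N^α_c`: the number of parts of `Λ^c` (equal to `α`) whose rightmost node is in `P`. -/
noncomputable def NalP (e : ℕ) (P : ℕ → Node l) (c : Fin (l + 1)) : ℕ :=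
  Nat.card {i : ℕ // i < e ∧ (P i).comp = c}

/-- The number of rows of component `c` above row `r` whose rightmost node is in `P`. -/
noncomputable def PAbove (e : ℕ) (P : ℕ → Node l) (c : Fin (l + 1)) (r : ℕ) : ℕ :=
  Nat.card {i : ℕ // i < e ∧ (P i).comp = c ∧ (P i).row < r}

/-- `μ = ψ(Λ)`: for each component `C`, `μ^C` consists of the parts of `Λ^C` smaller
than `α`, the parts of `Λ^C` equal to `α` whose rightmost node is not in `P`, and the
parts of `Λ^{C−1}` (cyclically) greater than `α`; specified via part multiplicities. -/
def IsPsi (e : ℕ) (P : ℕ → Node l) (α : ℕ) (Λ μ : MultiPartition l) : Prop :=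
  ∀ C : Fin (l + 1), ∀ v : ℕ, 1 ≤ v →
    countParts (μ C) v =
      if v < α then countParts (Λ C) v
      else if v = α then countParts (Λ C) α - NalP e P C
      else countParts (Λ (prevComp C)) v

/-- The canonical association between nodes of `Λ` (outside the rows of `P`) and
nodes of `ψ(Λ)`: boxes of parts `> α` keep their row and move one component up
(cyclically), boxes of kept parts `≤ α` stay in their component, their row being
shifted by the number of rows removed above minus the number of rows inserted above. -/
def CanonAssoc (e : ℕ) (Λ : MultiPartition l) (α : ℕ) (P : ℕ → Node l)
    (γ Γ : Node l) : Prop :=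
  Γ.col = γ.col ∧
  ( (α < (Λ γ.comp).part γ.row ∧ Γ.comp = rho l γ.comp ∧ Γ.row = γ.row)
  ∨ ((Λ γ.comp).part γ.row ≤ α ∧
      (∀ i, i < e → ¬ ((P i).comp = γ.comp ∧ (P i).row = γ.row)) ∧
      Γ.comp = γ.comp ∧
      Γ.row + NgtA Λ α γ.comp + PAbove e P γ.comp γ.row
        = γ.row + NgtA Λ α (prevComp γ.comp)) )

/-- The entry of the `s`-symbol of `Λ` of size `p` in row `c` and column `k`
(`1 ≤ k ≤ p + s_c`): `b^c_a = λ^c_a − a + p + s_c` with `a = p + s_c − k + 1`. -/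
def symbolEntry (s : Fin (l + 1) → ℤ) (Λ : MultiPartition l) (p : ℤ)
    (c : Fin (l + 1)) (k : ℕ) : ℤ :=
  ((Λ c).part (p + s c - (k : ℤ) + 1).toNat : ℤ) - (p + s c - (k : ℤ) + 1) + p + s c

/-- `p` is an admissible size for the `s`-symbol of `Λ`:
`p ≥ 1 − s_c + h(λ^c)` for all `c`. -/
def SizeOK (s : Fin (l + 1) → ℤ) (Λ : MultiPartition l) (p : ℤ) : Prop :=
  ∀ c, 1 ≤ p + s c ∧ ∀ a : ℕ, p + s c ≤ (a : ℤ) → (Λ c).part a = 0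

/-- The `s`-symbol of `Λ` of size `p` is semistandard: `s` is non-decreasing, the
entries in each column are non-decreasing (read from the row with the larger index
down to the row with the smaller one), and the entries in each row are increasing. -/
def SemistandardAt (s : Fin (l + 1) → ℤ) (Λ : MultiPartition l) (p : ℤ) : Prop :=
  Monotone s ∧
  (∀ c c' : Fin (l + 1), c < c' → ∀ k : ℕ, 1 ≤ k → (k : ℤ) ≤ p + s c →
      symbolEntry s Λ p c' k ≤ symbolEntry s Λ p c k) ∧
  ∀ c, ∀ k : ℕ, 1 ≤ k → (k : ℤ) + 1 ≤ p + s c →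
      symbolEntry s Λ p c k < symbolEntry s Λ p c (k + 1)

/-- The `s`-symbol of `Λ` is semistandard (for every admissible size). -/
def Semistandard (s : Fin (l + 1) → ℤ) (Λ : MultiPartition l) : Prop :=
  ∀ p : ℤ, SizeOK s Λ p → SemistandardAt s Λ p

/-- The index of the column of the symbol of size `p` containing the entry
corresponding to the node `γ`. -/
def colOf (s : Fin (l + 1) → ℤ) (p : ℤ) (γ : Node l) : ℤ :=
  p + s γ.comp - (γ.row : ℤ) + 1


theorem Partition.part_le_part (π : Partition) {a b : ℕ} (ha : 1 ≤ a) (hab : a ≤ b) :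
    π.part b ≤ π.part a := by
  induction b, hab using Nat.le_induction with
  | base => exact le_rfl
  | succ n hn ih => exact (π.antitone n (ha.trans hn)).trans ih

theorem InSe.monotone {e : ℕ} {s : Fin (l + 1) → ℤ} (hs : InSe e s) : Monotone s := by
  intro c d hcd
  rcases hcd.eq_or_lt with rfl | h
  · exact le_rfl
  · have := (hs c d h).1
    omega

/-- Comparison of the parts of two components whose charges differ, without wrap-around. -/
theorem Cylindric.part_le_of_le {e : ℕ} {s : Fin (l + 1) → ℤ} {Λ : MultiPartition l}
    (hs : InSe e s) (hcyl : Cylindric e s Λ) {c d : Fin (l + 1)} (hcd : c ≤ d) {a b : ℕ}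
    (ha : 1 ≤ a) (hab : (a : ℤ) + s d - s c ≤ b) :
    (Λ d).part b ≤ (Λ c).part a := by
  induction d using Fin.induction generalizing b with
  | zero =>
    obtain rfl : c = 0 := le_antisymm hcd (Fin.zero_le c)
    exact (Λ 0).part_le_part ha (by omega)
  | succ i ih =>
    rcases hcd.eq_or_lt with rfl | h
    · exact Partition.part_le_part _ ha (by omega)
    · have hci : c ≤ i.castSucc := Fin.le_castSucc_iff.mpr h
      have h₁ := hs.monotone hci
      have h₂ := hs.monotone (Fin.castSucc_lt_succ (i := i)).le
      refine le_trans ?_ (ih hci (b := b - (s i.succ - s i.castSucc).toNat) (by omega))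
      have h := hcyl.1 i (b - (s i.succ - s i.castSucc).toNat) (by omega)
      rwa [Nat.sub_add_cancel (by omega)] at h

/-- Comparison of the parts of two arbitrary components, after a shift by `e`. -/
theorem Cylindric.part_le {e : ℕ} {s : Fin (l + 1) → ℤ} {Λ : MultiPartition l}
    (he : 1 ≤ e) (hs : InSe e s) (hcyl : Cylindric e s Λ) (c d : Fin (l + 1)) {a b : ℕ}
    (ha : 1 ≤ a) (hab : (a : ℤ) + e + s c - s d ≤ b) :
    (Λ c).part b ≤ (Λ d).part a := by
  have bound : ∀ c : Fin (l + 1), s c - s 0 < e := by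
    intro c
    rcases (Fin.zero_le c).eq_or_lt with rfl | h
    · omega
    · exact (hs 0 c h).2
  have h₁ := bound c
  have h₂ := bound d
  have h₃ := bound (Fin.last l)
  have h₄ := hs.monotone (Fin.le_last d)
  calc (Λ c).part b
      ≤ (Λ 0).part (b - s c + s 0).toNat :=
        hcyl.part_le_of_le hs (Fin.zero_le c) (by omega) (by omega)
    _ ≤ (Λ (Fin.last l)).part (b - s c + s (Fin.last l) - e).toNat := by
        convert hcyl.2 (b - s c + s (Fin.last l) - e).toNat (by omega) using 2
        omega
    _ ≤ (Λ d).part a := hcyl.part_le_of_le hs (Fin.le_last d) ha (by omega)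

/-- If the parts of size `α` cover all residues, then every integer less than `e` below the
maximal content of their rightmost nodes is itself such a content. -/
theorem exists_rightmostAt_content_eq {e : ℕ} {s : Fin (l + 1) → ℤ} {Λ : MultiPartition l}
    {α : ℕ} {γ : Node l} (he : 1 ≤ e) (hs : InSe e s) (hcyl : Cylindric e s Λ)
    (hcov : Covers e s Λ α) (hγ : RightmostAt Λ α γ)
    (hmax : ∀ δ, RightmostAt Λ α δ → content s δ ≤ content s γ) {g : ℤ}
    (hg : content s γ - e < g) (hg' : g ≤ content s γ) :
    ∃ δ, RightmostAt Λ α δ ∧ content s δ = g := by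
  have he' : (0 : ℤ) < e := by omega
  obtain ⟨δ, hδ, hmod⟩ := hcov (g % e) (Int.emod_nonneg _ he'.ne') (Int.emod_lt_of_pos _ he')
  obtain ⟨k, hk⟩ : (e : ℤ) ∣ g - content s δ := Int.ModEq.dvd hmod
  rcases lt_trichotomy k 0 with hk0 | rfl | hk0
  · have := hmax δ hδ
    nlinarith
  · exact ⟨δ, hδ, by omega⟩
  · have hle : content s δ + e ≤ g := by nlinarith
    obtain ⟨hγ₁, hγ₂, hγ₃⟩ := hγ
    obtain ⟨hδ₁, hδ₂, hδ₃⟩ := hδ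
    simp only [content, hγ₂, hδ₂] at hg' hle
    refine ⟨⟨(α + s γ.comp - g).toNat, α, γ.comp⟩, ⟨by dsimp only; omega, rfl, ?_⟩, ?_⟩
    · apply le_antisymm
      · exact hγ₃ ▸ Partition.part_le_part _ hγ₁ (by dsimp only; omega)
      · exact hδ₃ ▸ hcyl.part_le he hs δ.comp γ.comp (by dsimp only; omega)
          (by dsimp only; omega)
    · simp only [content]
      omega

/-- The contents of the nodes of the first pseudoperiod are consecutive. -/
theorem IsFirstPseudoperiod.content_eq {e : ℕ} {s : Fin (l + 1) → ℤ} {Λ : MultiPartition l}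
    {α : ℕ} {P : ℕ → Node l} (hs : InSe e s) (hcyl : Cylindric e s Λ)
    (hP : IsFirstPseudoperiod e s Λ α P) {i : ℕ} (hi : i < e) :
    content s (P i) = content s (P 0) - i := by
  obtain ⟨-, hcov, -, hmem, hmax, -, hstep⟩ := hP
  induction i with
  | zero => simp
  | succ n ih =>
    have hn := ih (by omega)
    obtain ⟨hlt, hnext, -⟩ := hstep n hi
    obtain ⟨δ, hδ, hδc⟩ := exists_rightmostAt_content_eq (by omega) hs hcyl hcov
      (hmem 0 (by omega)) hmax (g := content s (P 0) - (n + 1)) (by omega) (by omega)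
    have := hnext δ hδ (by omega)
    push_cast
    omega

/-!
STATEMENT 12: the entries of the s-symbol of λ corresponding to the nodes of the first
pseudoperiod P(λ) lie in pairwise distinct columns, and these columns are e
consecutive columns of the symbol.
-/
theorem pseudoperiod_entries_in_distinct_consecutive_columns
    (l e : ℕ) (he : 2 ≤ e) (s : Fin (l + 1) → ℤ) (Λ : MultiPartition l)
    (α : ℕ) (P : ℕ → Node l)
    (hs : InSe e s) (hcyl : Cylindric e s Λ) (hnf : ¬ FLOTW e s Λ)
    (hP : IsFirstPseudoperiod e s Λ α P) :
    ∀ p : ℤ, SizeOK s Λ p →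
      (∀ i j : ℕ, i < e → j < e → colOf s p (P i) = colOf s p (P j) → i = j) ∧
      ∃ k0 : ℤ,
        (∀ i : ℕ, i < e → k0 ≤ colOf s p (P i) ∧ colOf s p (P i) ≤ k0 + e - 1) ∧
        ∀ m : ℤ, k0 ≤ m → m ≤ k0 + e - 1 → ∃ i : ℕ, i < e ∧ colOf s p (P i) = m := by
  intro p _
  have hcol : ∀ i, i < e → colOf s p (P i) = content s (P 0) - i + p + 1 - α := by
    intro i hi
    have h₁ := hP.content_eq hs hcyl hi
    have h₂ := (hP.2.2.2.1 i hi).2.1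
    simp only [colOf]
    rw [← h₁, content, h₂]
    ring
  refine ⟨fun i j hi hj h => ?_, content s (P 0) + p + 2 - α - e, fun i hi => ?_,
    fun m hm hm' => ?_⟩
  · rw [hcol i hi, hcol j hj] at h
    omega
  · rw [hcol i hi]
    omega
  · refine ⟨(content s (P 0) + p + 1 - α - m).toNat, by omega, ?_⟩
    rw [hcol _ (by omega)]
    omega

end FockCrystal
end

section
/- Fix integers l ≥ 1 and e ≥ 2, let s ∈ S_e, let (λ,s) be cylindric and not FLOTW with first pseudoperiod P(λ) of width α, and let i ∈ {0,…,e−1}. Suppose γ⁺ = (a, α+1, c) is the good addable i-node of (λ,s), where γ = (a, α, c) belongs to P(λ). Then the good addable i-node of (ψ(λ), ξ(s)) is Δ⁺ = (a, α+1, c+1) if 1 ≤ c < l, and Δ⁺ = (a, α+1, 1) if c = l. -/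
namespace FockCrystal

variable {l : ℕ}

/-- The weight of a letter: `A` counts `1` and `R` counts `-1`. -/
def Letter.weight : Letter → ℤ
  | Letter.A => 1
  | Letter.R => -1

/-- The number of letters `A` minus the number of letters `R` of a word. -/
def wordWeight (w : List (Node l × Letter)) : ℤ := (w.map fun p => p.2.weight).sum

@[simp] theorem wordWeight_nil : wordWeight ([] : List (Node l × Letter)) = 0 := rfl

@[simp] theorem wordWeight_cons (p : Node l × Letter) (w : List (Node l × Letter)) :
    wordWeight (p :: w) = p.2.weight + wordWeight w := by
  simp [wordWeight]

theorem Letter.eq_R_of_ne_A {x : Letter} (h : x ≠ Letter.A) : x = Letter.R := by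
  cases x <;> simp_all

theorem reduceW_pairwise (w : List (Node l × Letter)) :
    (reduceW w).Pairwise fun p q => ¬(p.2 = Letter.R ∧ q.2 = Letter.A) := by
  induction w with
  | nil => simp [reduceW]
  | cons p ps ih =>
    rw [reduceW]
    rcases h : reduceW ps with _ | ⟨q, qs⟩
    · simp
    · rw [h] at ih
      dsimp only
      split_ifs with hpq
      · exact (List.pairwise_cons.1 ih).2
      · refine List.pairwise_cons.2 ⟨fun r hr hpr => ?_, ih⟩
        rcases List.mem_cons.1 hr with rfl | hr
        · exact hpq hpr
        · have := (List.pairwise_cons.1 ih).1 r hr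
          have hq : q.2 ≠ Letter.A := fun hq => hpq ⟨hpr.1, hq⟩
          exact this ⟨Letter.eq_R_of_ne_A hq, hpr.2⟩

theorem reduceW_cons_A (γ : Node l) (w : List (Node l × Letter)) :
    reduceW ((γ, Letter.A) :: w) = (γ, Letter.A) :: reduceW w := by
  rw [reduceW]
  rcases reduceW w with _ | ⟨q, qs⟩ <;> simp

/-- The number of letters `A` in the reduced word is the largest weight of a prefix. -/
theorem countP_reduceW_le_iff (w : List (Node l × Letter)) (k : ℕ) :
    (reduceW w).countP (fun p => p.2 = Letter.A) ≤ k ↔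
      ∀ t, t <+: w → wordWeight t ≤ k := by
  induction w generalizing k with
  | nil => simp [reduceW]
  | cons p ps ih =>
    obtain ⟨γ, x⟩ := p
    cases x with
    | A =>
      rw [reduceW_cons_A, List.countP_cons_of_pos (by simp)]
      constructor
      · rintro h t ht
        rcases List.prefix_cons_iff.1 ht with rfl | ⟨t', rfl, ht'⟩
        · simp
        · have := (ih (k - 1)).1 (by omega) t' ht'
          simp only [wordWeight_cons, Letter.weight]
          omega
      · intro h
        have h1 := h [(γ, Letter.A)] (by simp)
        simp only [wordWeight_cons, Letter.weight, wordWeight_nil] at h1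
        have := (ih (k - 1)).2 fun t ht => by
          have := h ((γ, Letter.A) :: t) (by simpa using ht)
          simp only [wordWeight_cons, Letter.weight] at this
          omega
        omega
    | R =>
      have hc : (reduceW ((γ, Letter.R) :: ps)).countP (fun p => p.2 = Letter.A) ≤ k ↔
          (reduceW ps).countP (fun p => p.2 = Letter.A) ≤ k + 1 := by
        rw [reduceW]
        have hpw := reduceW_pairwise ps
        rcases h : reduceW ps with _ | ⟨q, qs⟩
        · simp
        · rw [h] at hpw
          by_cases hq : q.2 = Letter.A
          · simp [hq]
          · have h0 : qs.countP (fun p => p.2 = Letter.A) = 0 := by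
              rw [List.countP_eq_zero]
              intro r hr
              have := (List.pairwise_cons.1 hpw).1 r hr
              simpa [Letter.eq_R_of_ne_A hq] using this
            simp [hq, h0]
      rw [hc, ih]
      constructor
      · rintro h t ht
        rcases List.prefix_cons_iff.1 ht with rfl | ⟨t', rfl, ht'⟩
        · simp
        · have := h t' ht'
          simp only [wordWeight_cons, Letter.weight]
          push_cast at this
          omega
      · intro h t ht
        have := h ((γ, Letter.R) :: t) (by simpa using ht)
        simp only [wordWeight_cons, Letter.weight] at this
        push_cast
        omega

theorem reduceW_forall_R_iff (w : List (Node l × Letter)) :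
    (∀ p ∈ reduceW w, p.2 = Letter.R) ↔ ∀ t, t <+: w → wordWeight t ≤ 0 := by
  have := countP_reduceW_le_iff w 0
  rw [Nat.le_zero, List.countP_eq_zero] at this
  simp only [decide_eq_true_eq, Nat.cast_zero] at this
  rw [← this]
  refine forall₂_congr fun p _ => ⟨fun h => by simp [h], Letter.eq_R_of_ne_A⟩

theorem reduceW_append (w₁ w₂ : List (Node l × Letter)) (γ : Node l)
    (h₁ : ∀ t, t <:+ w₁ → 0 ≤ wordWeight t) :
    ∃ u, reduceW (w₁ ++ (γ, Letter.A) :: w₂) = u ++ (γ, Letter.A) :: reduceW w₂ ∧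
      (∀ p ∈ u, p.2 = Letter.A) ∧ (u.length : ℤ) = wordWeight w₁ := by
  induction w₁ with
  | nil => exact ⟨[], by simp [reduceW_cons_A]⟩
  | cons p ps ih =>
    obtain ⟨u, hu, huA, hlen⟩ := ih fun t ht => h₁ t (ht.trans (List.suffix_cons p ps))
    obtain ⟨δ, x⟩ := p
    cases x with
    | A =>
      refine ⟨(δ, Letter.A) :: u, ?_, ?_, ?_⟩
      · rw [List.cons_append, reduceW_cons_A, hu, List.cons_append]
      · simpa using huA
      · simp [hlen, Letter.weight, add_comm]
    | R =>
      have h := h₁ _ List.suffix_rfl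
      simp only [wordWeight_cons, Letter.weight] at h
      rcases u with _ | ⟨q, qs⟩
      · simp at hlen
        omega
      · refine ⟨qs, ?_, fun p hp => huA p (List.mem_cons_of_mem _ hp), ?_⟩
        · rw [List.cons_append, reduceW, hu, List.cons_append]
          simp [huA q]
        · simp only [List.length_cons, Nat.cast_add, Nat.cast_one] at hlen
          simp only [wordWeight_cons, Letter.weight]
          omega

theorem exists_decomp_of_reduceW (w u v : List (Node l × Letter)) (γ : Node l)
    (h : reduceW w = u ++ (γ, Letter.A) :: v) (hv : ∀ p ∈ v, p.2 = Letter.R) :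
    ∃ w₁ w₂, w = w₁ ++ (γ, Letter.A) :: w₂ ∧ (u.length : ℤ) = wordWeight w₁ ∧
      (∀ t, t <:+ w₁ → 0 ≤ wordWeight t) ∧ ∀ p ∈ reduceW w₂, p.2 = Letter.R := by
  induction w generalizing u with
  | nil => simp [reduceW] at h
  | cons p ps ih =>
    obtain ⟨δ, x⟩ := p
    cases x with
    | A =>
      rw [reduceW_cons_A] at h
      rcases u with _ | ⟨q, u⟩
      · simp only [List.nil_append, List.cons.injEq, Prod.mk.injEq, and_true] at h
        obtain ⟨rfl, rfl⟩ := h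
        exact ⟨[], ps, by simpa using hv⟩
      · simp only [List.cons_append, List.cons.injEq] at h
        obtain ⟨rfl, h⟩ := h
        obtain ⟨w₁, w₂, rfl, hlen, hs, hR⟩ := ih u h
        refine ⟨(δ, Letter.A) :: w₁, w₂, rfl, ?_, fun t ht => ?_, hR⟩
        · simp [← hlen, Letter.weight, add_comm]
        · rcases List.suffix_cons_iff.1 ht with rfl | ht
          · simp only [wordWeight_cons, Letter.weight]
            omega
          · exact hs t ht
    | R =>
      have hpw := reduceW_pairwise ps
      rw [reduceW] at h
      rcases h' : reduceW ps with _ | ⟨q, qs⟩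
      · rw [h'] at h
        rcases u with _ | ⟨q, u⟩ <;> simp at h
      · rw [h'] at h hpw
        dsimp only at h
        split_ifs at h with hq
        · obtain ⟨w₁, w₂, rfl, hlen, hs, hR⟩ := ih (q :: u) (by rw [h', h, List.cons_append])
          simp only [List.length_cons, Nat.cast_add, Nat.cast_one] at hlen
          refine ⟨(δ, Letter.R) :: w₁, w₂, rfl, ?_, fun t ht => ?_, hR⟩
          · simp only [wordWeight_cons, Letter.weight]
            omega
          · rcases List.suffix_cons_iff.1 ht with rfl | ht
            · simp only [wordWeight_cons, Letter.weight]
              omega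
            · exact hs t ht
        · exfalso
          have hmem : (γ, Letter.A) ∈ q :: qs := by
            have : (γ, Letter.A) ∈ (δ, Letter.R) :: q :: qs := by simp [h]
            simpa using this
          have hqR : q.2 = Letter.R := Letter.eq_R_of_ne_A fun hA => hq ⟨rfl, hA⟩
          rcases List.mem_cons.1 hmem with rfl | hmem
          · simp at hqR
          · exact (List.pairwise_cons.1 hpw).1 _ hmem ⟨hqR, rfl⟩

theorem goodAddableWord_iff (w : List (Node l × Letter)) (γ : Node l) :
    GoodAddableWord w γ ↔ ∃ w₁ w₂, w = w₁ ++ (γ, Letter.A) :: w₂ ∧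
      (∀ t, t <:+ w₁ → 0 ≤ wordWeight t) ∧ ∀ t, t <+: w₂ → wordWeight t ≤ 0 := by
  constructor
  · rintro ⟨u, v, h, hv⟩
    obtain ⟨w₁, w₂, hw, -, h₁, h₂⟩ := exists_decomp_of_reduceW w u v γ h hv
    exact ⟨w₁, w₂, hw, h₁, (reduceW_forall_R_iff w₂).1 h₂⟩
  · rintro ⟨w₁, w₂, rfl, h₁, h₂⟩
    obtain ⟨u, hu, -⟩ := reduceW_append w₁ w₂ γ h₁
    exact ⟨u, _, hu, (reduceW_forall_R_iff w₂).2 h₂⟩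

/-- The weight of the letters of a word whose node has key `C`. -/
def keyWeight (κ : Node l → ℤ) (w : List (Node l × Letter)) (C : ℤ) : ℤ :=
  (w.map fun p => if κ p.1 = C then p.2.weight else 0).sum

theorem sum_keyWeight (κ : Node l → ℤ) (w : List (Node l × Letter)) (I : Finset ℤ) :
    ∑ C ∈ I, keyWeight κ w C =
      (w.map fun p => if κ p.1 ∈ I then p.2.weight else 0).sum := by
  induction w with
  | nil => simp [keyWeight]
  | cons p w ih =>
    simp only [keyWeight, List.map_cons, List.sum_cons, Finset.sum_add_distrib,
      Finset.sum_ite_eq] at ih ⊢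
    rw [ih]

theorem sum_map_ite_of_forall_mem (w : List (Node l × Letter)) (Q : Node l → Prop)
    [DecidablePred Q] (h : ∀ p ∈ w, Q p.1) :
    (w.map fun p => if Q p.1 then p.2.weight else 0).sum = wordWeight w := by
  rw [wordWeight]
  congr 1
  exact List.map_congr_left fun p hp => if_pos (h p hp)

theorem sum_map_ite_of_forall_notMem (w : List (Node l × Letter)) (Q : Node l → Prop)
    [DecidablePred Q] (h : ∀ p ∈ w, ¬ Q p.1) :
    (w.map fun p => if Q p.1 then p.2.weight else 0).sum = 0 := by
  refine List.sum_eq_zero fun x hx => ?_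
  obtain ⟨p, hp, rfl⟩ := List.mem_map.1 hx
  exact if_neg (h p hp)

theorem sum_keyWeight_append (κ : Node l → ℤ) (x t y : List (Node l × Letter)) (I : Finset ℤ)
    (hx : ∀ p ∈ x, κ p.1 ∉ I) (ht : ∀ p ∈ t, κ p.1 ∈ I) (hy : ∀ p ∈ y, κ p.1 ∉ I) :
    ∑ C ∈ I, keyWeight κ (x ++ t ++ y) C = wordWeight t := by
  rw [sum_keyWeight, List.map_append, List.map_append, List.sum_append, List.sum_append,
    sum_map_ite_of_forall_mem t (fun γ => κ γ ∈ I) ht,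
    sum_map_ite_of_forall_notMem x (fun γ => κ γ ∈ I) hx,
    sum_map_ite_of_forall_notMem y (fun γ => κ γ ∈ I) hy]
  ring

/-- `C₀` is the last step (in decreasing order of the argument) at which the sum of `L`
reaches its maximum from below. -/
def IsPeak (L : ℤ → ℤ) (C₀ : ℤ) : Prop :=
  (∀ D, C₀ < D → 0 ≤ ∑ C ∈ Finset.Ioc C₀ D, L C) ∧
    ∀ D, D < C₀ → ∑ C ∈ Finset.Ico D C₀, L C ≤ 0

theorem exists_append_of_sorted (κ : Node l → ℤ) (w : List (Node l × Letter))
    (hw : w.Pairwise fun p q => κ q.1 < κ p.1) (D : ℤ) :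
    ∃ x y, w = x ++ y ∧ (∀ p ∈ x, D < κ p.1) ∧ ∀ p ∈ y, κ p.1 ≤ D := by
  induction w with
  | nil => exact ⟨[], [], by simp⟩
  | cons p w ih =>
    obtain ⟨hp, hw⟩ := List.pairwise_cons.1 hw
    by_cases h : D < κ p.1
    · obtain ⟨x, y, rfl, hx, hy⟩ := ih hw
      exact ⟨p :: x, y, rfl, by simpa using ⟨h, by simpa using hx⟩, hy⟩
    · refine ⟨[], p :: w, rfl, by simp, fun q hq => ?_⟩
      rcases List.mem_cons.1 hq with rfl | hq
      · omega
      · have := hp q hq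
        omega

theorem goodAddableWord_iff_isPeak (κ : Node l → ℤ) (w : List (Node l × Letter))
    (hw : w.Pairwise fun p q => κ q.1 < κ p.1) (γ : Node l) :
    GoodAddableWord w γ ↔ (γ, Letter.A) ∈ w ∧ IsPeak (keyWeight κ w) (κ γ) := by
  rw [goodAddableWord_iff]
  constructor
  · rintro ⟨w₁, w₂, rfl, h₁, h₂⟩
    obtain ⟨hw₁, hw₂, hw₁₂⟩ := List.pairwise_append.1 hw
    have hw₂γ : ∀ p ∈ w₂, κ p.1 < κ γ := (List.pairwise_cons.1 hw₂).1
    replace hw₂ := (List.pairwise_cons.1 hw₂).2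
    have hw₁γ : ∀ p ∈ w₁, κ γ < κ p.1 := fun p hp => hw₁₂ p hp (γ, Letter.A) (by simp)
    refine ⟨by simp, fun D hD => ?_, fun D hD => ?_⟩
    · obtain ⟨x, t, rfl, hx, ht⟩ := exists_append_of_sorted κ w₁ hw₁ D
      rw [sum_keyWeight_append]
      · exact h₁ t (List.suffix_append x t)
      · intro p hp
        have := hx p hp
        simp only [Finset.mem_Ioc]
        omega
      · intro p hp
        have := ht p hp
        have := hw₁γ p (List.mem_append_right _ hp)
        simp only [Finset.mem_Ioc]
        omega
      · intro p hp
        simp only [Finset.mem_Ioc]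
        rcases List.mem_cons.1 hp with rfl | hp
        · simp
        · have := hw₂γ p hp
          omega
    · obtain ⟨t, y, rfl, ht, hy⟩ := exists_append_of_sorted κ w₂ hw₂ (D - 1)
      rw [show w₁ ++ (γ, Letter.A) :: (t ++ y) = (w₁ ++ [(γ, Letter.A)]) ++ t ++ y by simp,
        sum_keyWeight_append]
      · exact h₂ t (List.prefix_append t y)
      · intro p hp
        simp only [Finset.mem_Ico]
        rcases List.mem_append.1 hp with hp | hp
        · have := hw₁γ p hp
          omega
        · obtain rfl := List.mem_singleton.1 hp
          simp
      · intro p hp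
        have := ht p hp
        have := hw₂γ p (List.mem_append_left _ hp)
        simp only [Finset.mem_Ico]
        omega
      · intro p hp
        have := hy p hp
        simp only [Finset.mem_Ico]
        omega
  · rintro ⟨hmem, h₁, h₂⟩
    obtain ⟨w₁, w₂, rfl⟩ := List.append_of_mem hmem
    obtain ⟨hw₁, hw₂, hw₁₂⟩ := List.pairwise_append.1 hw
    have hw₂γ : ∀ p ∈ w₂, κ p.1 < κ γ := (List.pairwise_cons.1 hw₂).1
    replace hw₂ := (List.pairwise_cons.1 hw₂).2
    have hw₁γ : ∀ p ∈ w₁, κ γ < κ p.1 := fun p hp => hw₁₂ p hp (γ, Letter.A) (by simp)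
    refine ⟨w₁, w₂, rfl, fun t ht => ?_, fun t ht => ?_⟩
    · obtain ⟨x, rfl⟩ := ht
      rcases t with _ | ⟨p, t⟩
      · simp
      obtain ⟨-, hpt, hx⟩ := List.pairwise_append.1 hw₁
      have h := h₁ (κ p.1) (hw₁γ p (by simp))
      rw [sum_keyWeight_append] at h
      · exact h
      · intro q hq
        have := hx q hq p (by simp)
        simp only [Finset.mem_Ioc]
        omega
      · intro q hq
        have := hw₁γ q (List.mem_append_right _ hq)
        simp only [Finset.mem_Ioc]
        rcases List.mem_cons.1 hq with rfl | hq
        · omega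
        · have := (List.pairwise_cons.1 hpt).1 q hq
          omega
      · intro q hq
        simp only [Finset.mem_Ioc]
        rcases List.mem_cons.1 hq with rfl | hq
        · simp
        · have := hw₂γ q hq
          omega
    · obtain ⟨y, rfl⟩ := ht
      rcases List.eq_nil_or_concat t with rfl | ⟨t, p, rfl⟩
      · simp
      rw [List.concat_eq_append] at *
      obtain ⟨hpt, -, hy⟩ := List.pairwise_append.1 hw₂
      have h := h₂ (κ p.1) (hw₂γ p (by simp))
      rw [show w₁ ++ (γ, Letter.A) :: ((t ++ [p]) ++ y) =
        (w₁ ++ [(γ, Letter.A)]) ++ (t ++ [p]) ++ y by simp, sum_keyWeight_append] at h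
      · exact h
      · intro q hq
        simp only [Finset.mem_Ico]
        rcases List.mem_append.1 hq with hq | hq
        · have := hw₁γ q hq
          omega
        · obtain rfl := List.mem_singleton.1 hq
          simp
      · intro q hq
        have := hw₂γ q (List.mem_append_left _ hq)
        simp only [Finset.mem_Ico]
        rcases List.mem_append.1 hq with hq | hq
        · have := (List.pairwise_append.1 hpt).2.2 q hq p (by simp)
          omega
        · obtain rfl := List.mem_singleton.1 hq
          omega
      · intro q hq
        have := hy p (by simp) q hq
        simp only [Finset.mem_Ico]
        omega

theorem keyWeight_eq_of_mem (κ : Node l → ℤ) (w : List (Node l × Letter))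
    (hw : w.Pairwise fun p q => κ q.1 < κ p.1) {p : Node l × Letter} (hp : p ∈ w) :
    keyWeight κ w (κ p.1) = p.2.weight := by
  obtain ⟨x, y, rfl⟩ := List.append_of_mem hp
  obtain ⟨-, hy, hx⟩ := List.pairwise_append.1 hw
  have := sum_keyWeight_append κ x [p] y {κ p.1}
    (fun q hq => by simpa using (hx q hq p (by simp)).ne') (by simp)
    (fun q hq => by simpa using ((List.pairwise_cons.1 hy).1 q hq).ne)
  simpa using this

theorem keyWeight_eq_zero (κ : Node l → ℤ) (w : List (Node l × Letter)) (C : ℤ)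
    (h : ∀ p ∈ w, κ p.1 ≠ C) : keyWeight κ w C = 0 :=
  sum_map_ite_of_forall_notMem w (fun γ => κ γ = C) h

/-- The component `C` modulo the number of components. -/
def compOf (l : ℕ) (C : ℤ) : Fin (l + 1) :=
  ⟨(C % (l + 1 : ℤ)).toNat, by
    have := Int.emod_lt_of_pos C (b := (l + 1 : ℤ)) (by omega)
    omega⟩

/-- The charge extended to all integers, with `s_{C + l} = s_C + e`. -/
def extCharge (e : ℕ) (s : Fin (l + 1) → ℤ) (C : ℤ) : ℤ :=
  s (compOf l C) + e * (C / (l + 1 : ℤ))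

/-- `b` belongs to the beta-set of the component `C` of the periodically extended
multipartition. -/
def IsBead (e : ℕ) (s : Fin (l + 1) → ℤ) (Λ : MultiPartition l) (C b : ℤ) : Prop :=
  ∃ a : ℕ, 1 ≤ a ∧ ((Λ (compOf l C)).part a : ℤ) - a + extCharge e s C = b

/-- The component of the translate of the node `γ` whose content lies in `{0,…,e−1}`. -/
def key (e : ℕ) (s : Fin (l + 1) → ℤ) (γ : Node l) : ℤ :=
  γ.comp.val - (l + 1) * (content s γ / e)

open Classical in
/-- The weight of the letter of residue `i` in the component `C` of the periodically
extended multipartition. -/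
noncomputable def letterWeight (e : ℕ) (s : Fin (l + 1) → ℤ) (Λ : MultiPartition l)
    (i C : ℤ) : ℤ :=
  (if IsBead e s Λ C (i - 1) then 1 else 0) - if IsBead e s Λ C i then 1 else 0

theorem compOf_add_mul (c : Fin (l + 1)) (q : ℤ) : compOf l (c.val + (l + 1) * q) = c := by
  apply Fin.ext
  have h := c.isLt
  have : (c.val + (l + 1) * q : ℤ) % (l + 1 : ℤ) = c.val := by
    rw [Int.add_mul_emod_self_left]
    exact Int.emod_eq_of_lt (by omega) (by omega)
  simp only [compOf, this]
  simp

theorem add_mul_ediv_eq (c : Fin (l + 1)) (q : ℤ) :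
    ((c.val : ℤ) + (l + 1) * q) / (l + 1 : ℤ) = q := by
  have h := c.isLt
  rw [Int.add_mul_ediv_left _ _ (by omega), Int.ediv_eq_zero_of_lt (by omega) (by omega), zero_add]

theorem extCharge_add_mul (e : ℕ) (s : Fin (l + 1) → ℤ) (c : Fin (l + 1)) (q : ℤ) :
    extCharge e s (c.val + (l + 1) * q) = s c + e * q := by
  rw [extCharge, compOf_add_mul, add_mul_ediv_eq]

theorem exists_eq_add_mul (l : ℕ) (C : ℤ) :
    ∃ (c : Fin (l + 1)) (q : ℤ), C = c.val + (l + 1) * q := by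
  have h0 := Int.emod_nonneg C (b := (l + 1 : ℤ)) (by omega)
  refine ⟨compOf l C, C / (l + 1 : ℤ), ?_⟩
  have := Int.emod_add_mul_ediv C (l + 1 : ℤ)
  simp only [compOf]
  rw [Int.toNat_of_nonneg h0]
  omega

theorem compOf_key (e : ℕ) (s : Fin (l + 1) → ℤ) (γ : Node l) :
    compOf l (key e s γ) = γ.comp := by
  have := compOf_add_mul γ.comp (-(content s γ / e))
  rwa [mul_neg, ← sub_eq_add_neg] at this

theorem extCharge_key (e : ℕ) (s : Fin (l + 1) → ℤ) (γ : Node l) :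
    extCharge e s (key e s γ) = s γ.comp - e * (content s γ / e) := by
  have := extCharge_add_mul e s γ.comp (-(content s γ / e))
  rwa [mul_neg, ← sub_eq_add_neg, mul_neg, ← sub_eq_add_neg] at this

section Letters

variable {e : ℕ} {s : Fin (l + 1) → ℤ} {Λ : MultiPartition l} {i : ℤ}

theorem col_sub_row_add_extCharge {γ : Node l} (hi : content s γ % e = i) :
    (γ.col : ℤ) - γ.row + extCharge e s (key e s γ) = i := by
  have := Int.emod_add_mul_ediv (content s γ) e
  rw [extCharge_key]
  simp only [content] at *
  omega

theorem Addable.isBead {γ : Node l} (h : Addable Λ γ) (hi : content s γ % e = i) :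
    IsBead e s Λ (key e s γ) (i - 1) ∧ ¬ IsBead e s Λ (key e s γ) i := by
  obtain ⟨h1, h2, h3⟩ := h
  have hc := col_sub_row_add_extCharge hi
  simp only [IsBead, compOf_key]
  refine ⟨⟨γ.row, h1, by omega⟩, ?_⟩
  rintro ⟨a, ha, hb⟩
  rcases lt_or_ge a γ.row with h | h
  · have := (Λ γ.comp).part_le_part (a := a) (b := γ.row - 1) ha (by omega)
    omega
  · have := (Λ γ.comp).part_le_part h1 h
    omega

theorem Removable.isBead {γ : Node l} (h : Removable Λ γ) (hi : content s γ % e = i) :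
    IsBead e s Λ (key e s γ) i ∧ ¬ IsBead e s Λ (key e s γ) (i - 1) := by
  obtain ⟨h1, h2, h3, h4⟩ := h
  have hc := col_sub_row_add_extCharge hi
  simp only [IsBead, compOf_key]
  refine ⟨⟨γ.row, h1, by omega⟩, ?_⟩
  rintro ⟨a, ha, hb⟩
  rcases le_or_gt a γ.row with h | h
  · have := (Λ γ.comp).part_le_part ha h
    omega
  · have := (Λ γ.comp).part_le_part (a := γ.row + 1) (by omega) h
    omega

theorem content_and_key_of_extCharge (hi0 : 0 ≤ i) (hie : i < e) {C : ℤ} {a b : ℕ}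
    (h : (b : ℤ) - a + extCharge e s C = i) :
    content s ⟨a, b, compOf l C⟩ % e = i ∧ key e s ⟨a, b, compOf l C⟩ = C := by
  obtain ⟨c, q, rfl⟩ := exists_eq_add_mul l C
  rw [extCharge_add_mul] at h
  rw [compOf_add_mul]
  have hc : content s ⟨a, b, c⟩ = i + e * (-q) := by
    simp only [content]
    linarith
  constructor
  · rw [hc, Int.add_mul_emod_self_left, Int.emod_eq_of_lt hi0 hie]
  · rw [key, hc, Int.add_mul_ediv_left _ _ (by omega), Int.ediv_eq_zero_of_lt hi0 hie]
    ring

theorem exists_addable (hi0 : 0 ≤ i) (hie : i < e) {C : ℤ}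
    (h : IsBead e s Λ C (i - 1)) (h' : ¬ IsBead e s Λ C i) :
    ∃ γ, Addable Λ γ ∧ content s γ % e = i ∧ key e s γ = C := by
  obtain ⟨a, ha, hb⟩ := h
  obtain ⟨h1, h2⟩ := content_and_key_of_extCharge (s := s) (C := C) (a := a)
    (b := (Λ (compOf l C)).part a + 1) hi0 hie (by push_cast; omega)
  refine ⟨_, ⟨ha, rfl, ?_⟩, h1, h2⟩
  by_contra! hcon
  obtain ⟨hne, hle⟩ := hcon
  dsimp only at hne hle
  have := (Λ (compOf l C)).part_le_part (a := a - 1) (b := a) (by omega) (by omega)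
  exact h' ⟨a - 1, by omega, by omega⟩

theorem exists_removable (hi0 : 0 ≤ i) (hie : i < e) {C : ℤ}
    (h : IsBead e s Λ C i) (h' : ¬ IsBead e s Λ C (i - 1)) :
    ∃ γ, Removable Λ γ ∧ content s γ % e = i ∧ key e s γ = C := by
  obtain ⟨a, ha, hb⟩ := h
  obtain ⟨h1, h2⟩ := content_and_key_of_extCharge (s := s) (C := C) (a := a)
    (b := (Λ (compOf l C)).part a) hi0 hie (by omega)
  have := (Λ (compOf l C)).part_le_part (a := a) (b := a + 1) (by omega) (by omega)
  have hlt : (Λ (compOf l C)).part (a + 1) < (Λ (compOf l C)).part a := by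
    by_contra! hcon
    exact h' ⟨a + 1, by omega, by push_cast; omega⟩
  exact ⟨_, ⟨ha, by dsimp only; omega, rfl, hlt⟩, h1, h2⟩

theorem eq_of_key_eq {γ γ' : Node l} (h : Addable Λ γ ∨ Removable Λ γ)
    (h' : Addable Λ γ' ∨ Removable Λ γ') (hi : content s γ % e = i)
    (hi' : content s γ' % e = i) (hkey : key e s γ = key e s γ') : γ = γ' := by
  have hcomp : γ.comp = γ'.comp := by rw [← compOf_key e s γ, hkey, compOf_key]
  have hb : (Addable Λ γ ∧ Addable Λ γ') ∨ (Removable Λ γ ∧ Removable Λ γ') := by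
    rcases h with h | h <;> rcases h' with h' | h'
    · exact Or.inl ⟨h, h'⟩
    · exact absurd (hkey ▸ (h'.isBead hi').1) (h.isBead hi).2
    · exact absurd (hkey ▸ (h.isBead hi).1) (h'.isBead hi').2
    · exact Or.inr ⟨h, h'⟩
  have hc := col_sub_row_add_extCharge hi
  have hc' := col_sub_row_add_extCharge hi'
  rw [← hkey] at hc'
  obtain ⟨a, b, c⟩ := γ
  obtain ⟨a', b', c'⟩ := γ'
  obtain rfl : c = c' := hcomp
  dsimp only at hc hc'
  have hrow : 1 ≤ a ∧ 1 ≤ a' ∧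
      (b : ℤ) - b' = (Λ c).part a - (Λ c).part a' := by
    rcases hb with ⟨⟨h1, h2, -⟩, h1', h2', -⟩ | ⟨⟨h1, -, h2, -⟩, h1', -, h2', -⟩ <;>
      dsimp only at h1 h2 h1' h2' <;> omega
  obtain ⟨h1, h1', h2⟩ := hrow
  have haa : a = a' := by
    rcases lt_trichotomy a a' with h | h | h
    · have := (Λ c).part_le_part h1 h.le
      omega
    · exact h
    · have := (Λ c).part_le_part h1' h.le
      omega
  subst haa
  obtain rfl : b = b' := by omega
  rfl

theorem nodeLt_iff_key_lt (hi0 : 0 ≤ i) (hie : i < e) {γ γ' : Node l}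
    (hi : content s γ % e = i) (hi' : content s γ' % e = i) :
    NodeLt s γ γ' ↔ key e s γ' < key e s γ := by
  have h1 := Int.emod_add_mul_ediv (content s γ) e
  have h2 := Int.emod_add_mul_ediv (content s γ') e
  have hc := γ.comp.isLt
  have hc' := γ'.comp.isLt
  rw [hi] at h1
  rw [hi'] at h2
  simp only [NodeLt, key, Fin.lt_def]
  generalize content s γ / e = q at *
  generalize content s γ' / e = q' at *
  rw [← h1, ← h2]
  have he : (0 : ℤ) < e := by omega
  have hl : (0 : ℤ) < l + 1 := by omega
  rcases lt_trichotomy q q' with h | h | h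
  · have : (e : ℤ) * q < e * q' := by gcongr
    have : (l + 1 : ℤ) * (q + 1) ≤ (l + 1) * q' := by gcongr; omega
    rw [mul_add] at this
    omega
  · subst h
    omega
  · have : (e : ℤ) * q' < e * q := by gcongr
    have : (l + 1 : ℤ) * (q' + 1) ≤ (l + 1) * q := by gcongr; omega
    rw [mul_add] at this
    omega

theorem finite_setOf_addable_or_removable (Λ : MultiPartition l) :
    {γ : Node l | Addable Λ γ ∨ Removable Λ γ}.Finite := by
  choose N hN using fun c => (Λ c).eventually_zero
  have hfin : (Set.range fun p : (Σ c : Fin (l + 1),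
      Fin (N c + 2) × Fin ((Λ c).part 1 + 2)) =>
      (⟨p.2.1, p.2.2, p.1⟩ : Node l)).Finite := Set.finite_range _
  refine hfin.subset ?_
  rintro ⟨a, b, c⟩ h
  have hab : a < N c + 2 ∧ b < (Λ c).part 1 + 2 := by
    have h0 := hN c
    rcases h with ⟨h1, h2, h3⟩ | ⟨h1, h2, h3, h4⟩
    · dsimp only at h1 h2 h3
      have := (Λ c).part_le_part le_rfl h1
      refine ⟨?_, by omega⟩
      by_contra! hcon
      have := h0 (a - 1) (by omega)
      omega
    · dsimp only at h1 h2 h3 h4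
      have := (Λ c).part_le_part le_rfl h1
      refine ⟨?_, by omega⟩
      by_contra! hcon
      have := h0 a (by omega)
      omega
  exact ⟨⟨c, ⟨a, hab.1⟩, ⟨b, hab.2⟩⟩, rfl⟩

theorem exists_isWordE (Λ : MultiPartition l) (s : Fin (l + 1) → ℤ) (hi0 : 0 ≤ i)
    (hie : i < e) : ∃ w, IsWordE Λ s e i w := by
  classical
  have hfin := (finite_setOf_addable_or_removable Λ).inter_of_left {γ | content s γ % e = i}
  let r : Node l → Node l → Prop := fun γ γ' => key e s γ' ≤ key e s γ
  have : Std.Total r := ⟨fun γ γ' => le_total _ _⟩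
  have : IsTrans (Node l) r := ⟨fun _ _ _ h h' => le_trans h' h⟩
  let L := List.insertionSort r hfin.toFinset.toList
  have hmem : ∀ γ, γ ∈ L ↔ (Addable Λ γ ∨ Removable Λ γ) ∧ content s γ % e = i := by
    intro γ
    simp only [L]
    rw [(List.perm_insertionSort r _).mem_iff]
    simp
  have hsorted : L.Pairwise r := List.pairwise_insertionSort r _
  have hnodup : L.Nodup :=
    (List.perm_insertionSort r _).nodup_iff.2 (Finset.nodup_toList _)
  refine ⟨L.map fun γ => (γ, if Addable Λ γ then Letter.A else Letter.R), ?_, ?_, ?_⟩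
  · rw [List.pairwise_map]
    refine (hsorted.and hnodup).imp_of_mem fun {γ γ'} hγ hγ' h => ?_
    obtain ⟨ho, hi⟩ := (hmem γ).1 hγ
    obtain ⟨ho', hi'⟩ := (hmem γ').1 hγ'
    exact (nodeLt_iff_key_lt hi0 hie hi hi').2
      (lt_of_le_of_ne h.1 fun hk => h.2 (eq_of_key_eq ho ho' hi hi' hk.symm))
  · intro γ
    rw [← hmem γ]
    simp
  · intro p hp
    obtain ⟨γ, hγ, rfl⟩ := List.mem_map.1 hp
    obtain ⟨ho, hi⟩ := (hmem γ).1 hγ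
    have hnot : Addable Λ γ → ¬ Removable Λ γ := fun h h' =>
      (h'.isBead hi).2 (h.isBead hi).1
    by_cases h : Addable Λ γ
    · simp [LetterOk, h, hnot h]
    · simp [LetterOk, h, ho.resolve_left h]

theorem keyWeight_eq_letterWeight (hi0 : 0 ≤ i) (hie : i < e) {w : List (Node l × Letter)}
    (hw : IsWordE Λ s e i w) (hsorted : w.Pairwise fun p q => key e s q.1 < key e s p.1) :
    keyWeight (key e s) w = letterWeight e s Λ i := by
  obtain ⟨-, hmem, hok⟩ := hw
  funext C
  have hA : ∀ γ, Addable Λ γ → content s γ % e = i → keyWeight (key e s) w (key e s γ) = 1 := by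
    intro γ h hi
    obtain ⟨x, hx⟩ := (hmem γ).2 ⟨Or.inl h, hi⟩
    have hxA : x = Letter.A := (hok _ hx).1.2 h
    subst hxA
    exact keyWeight_eq_of_mem _ _ hsorted hx
  have hR : ∀ γ, Removable Λ γ → content s γ % e = i →
      keyWeight (key e s) w (key e s γ) = -1 := by
    intro γ h hi
    obtain ⟨x, hx⟩ := (hmem γ).2 ⟨Or.inr h, hi⟩
    have hxR : x = Letter.R := (hok _ hx).2.2 h
    subst hxR
    exact keyWeight_eq_of_mem _ _ hsorted hx
  have h0 : (∀ γ, Addable Λ γ ∨ Removable Λ γ → content s γ % e = i → key e s γ ≠ C) →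
      keyWeight (key e s) w C = 0 := by
    intro h
    refine keyWeight_eq_zero _ _ _ fun p hp => ?_
    obtain ⟨ho, hi⟩ := (hmem p.1).1 ⟨p.2, hp⟩
    exact h p.1 ho hi
  rw [letterWeight]
  by_cases h1 : IsBead e s Λ C (i - 1) <;> by_cases h2 : IsBead e s Λ C i
  · rw [h0]
    · simp [h1, h2]
    · rintro γ (h | h) hi rfl
      · exact (h.isBead hi).2 h2
      · exact (h.isBead hi).2 h1
  · obtain ⟨γ, hγ, hi, rfl⟩ := exists_addable hi0 hie h1 h2
    simp [h1, h2, hA γ hγ hi]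
  · obtain ⟨γ, hγ, hi, rfl⟩ := exists_removable hi0 hie h2 h1
    simp [h1, h2, hR γ hγ hi]
  · rw [h0]
    · simp [h1, h2]
    · rintro γ (h | h) hi rfl
      · exact h1 (h.isBead hi).1
      · exact h2 (h.isBead hi).1

theorem goodAddable_iff (hi0 : 0 ≤ i) (hie : i < e) (γ : Node l) :
    GoodAddable Λ s e i γ ↔ Addable Λ γ ∧ content s γ % e = i ∧
      IsPeak (letterWeight e s Λ i) (key e s γ) := by
  have hsort : ∀ w, IsWordE Λ s e i w → w.Pairwise fun p q => key e s q.1 < key e s p.1 := by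
    intro w hw
    refine hw.1.imp_of_mem fun {p q} hp hq h => ?_
    exact (nodeLt_iff_key_lt hi0 hie ((hw.2.1 p.1).1 ⟨_, hp⟩).2 ((hw.2.1 q.1).1 ⟨_, hq⟩).2).1 h
  constructor
  · rintro ⟨w, hw, hgood⟩
    obtain ⟨hmem, hpeak⟩ := (goodAddableWord_iff_isPeak _ w (hsort w hw) γ).1 hgood
    rw [keyWeight_eq_letterWeight hi0 hie hw (hsort w hw)] at hpeak
    exact ⟨(hw.2.2 _ hmem).1.1 rfl, ((hw.2.1 γ).1 ⟨_, hmem⟩).2, hpeak⟩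
  · rintro ⟨hadd, hi, hpeak⟩
    obtain ⟨w, hw⟩ := exists_isWordE Λ s hi0 hie
    refine ⟨w, hw, (goodAddableWord_iff_isPeak _ w (hsort w hw) γ).2 ⟨?_, ?_⟩⟩
    · obtain ⟨x, hx⟩ := (hw.2.1 γ).2 ⟨Or.inl hadd, hi⟩
      have hxA : x = Letter.A := (hw.2.2 _ hx).1.2 hadd
      rwa [hxA] at hx
    · rwa [keyWeight_eq_letterWeight hi0 hie hw (hsort w hw)]

end Letters

theorem IsPeak.of_shift {L L' : ℤ → ℤ} {C₀ C₁ : ℤ} (h : IsPeak L C₀) (hlt : C₀ < C₁)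
    (hlow : ∀ D ≤ C₀, L' D = L (D - 1))
    (hhigh : ∀ D, C₀ < D → L' D = L D + if D = C₁ then 1 else 0)
    (hmid : ∀ D, C₀ < D → D ≤ C₁ → 0 ≤ L' D ∧ L' D ≤ L' (C₀ + 1))
    (hone : L' (C₀ + 1) ≤ 1) : L' (C₀ + 1) = 1 ∧ IsPeak L' (C₀ + 1) := by
  have hsum : ∀ D, C₁ ≤ D →
      ∑ C ∈ Finset.Ioc C₀ D, L' C = ∑ C ∈ Finset.Ioc C₀ D, L C + 1 := by
    intro D hD
    rw [Finset.sum_congr rfl fun C hC => hhigh C (Finset.mem_Ioc.1 hC).1,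
      Finset.sum_add_distrib, Finset.sum_ite_eq', if_pos (Finset.mem_Ioc.2 ⟨hlt, hD⟩)]
  have h1 : L' (C₀ + 1) = 1 := by
    by_contra hne
    have hnonpos : ∑ C ∈ Finset.Ioc C₀ C₁, L' C ≤ 0 := by
      refine Finset.sum_nonpos fun C hC => ?_
      have := hmid C (Finset.mem_Ioc.1 hC).1 (Finset.mem_Ioc.1 hC).2
      omega
    have := hsum C₁ le_rfl
    have := h.1 C₁ hlt
    omega
  refine ⟨h1, fun D hD => ?_, fun D hD => ?_⟩
  · rcases le_or_gt D C₁ with hD' | hD'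
    · refine Finset.sum_nonneg fun C hC => ?_
      obtain ⟨hC, hC'⟩ := Finset.mem_Ioc.1 hC
      exact (hmid C (by omega) (by omega)).1
    · have hins : Finset.Ioc C₀ D = insert (C₀ + 1) (Finset.Ioc (C₀ + 1) D) := by
        ext C
        simp only [Finset.mem_Ioc, Finset.mem_insert]
        omega
      have hs := hsum D hD'.le
      have := h.1 D (by omega)
      rw [hins, Finset.sum_insert (by simp), ← hins, h1] at hs
      omega
  · have hs : ∑ C ∈ Finset.Ico D (C₀ + 1), L' C = ∑ C ∈ Finset.Ico (D - 1) C₀, L C := by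
      have := Finset.sum_Ico_add' (fun C => L (C - 1)) (D - 1) C₀ 1
      simp only [add_sub_cancel_right, sub_add_cancel] at this
      rw [this]
      refine Finset.sum_congr rfl fun C hC => hlow C ?_
      have := (Finset.mem_Ico.1 hC).2
      omega
    rw [hs]
    exact h.2 _ (by omega)

/-- A cylindric plane partition every column of which contains the value `α`. -/
structure IsProfile (f : ℤ → ℤ → ℤ) (α : ℤ) : Prop where
  mono : ∀ C, Monotone (f C)
  anti : ∀ x, Antitone fun C => f C x
  exists_first : ∀ x, ∃ C, f C x = α ∧ α < f (C - 1) x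

namespace IsProfile

variable {f : ℤ → ℤ → ℤ} {α : ℤ}

theorem le_of_lt (hf : IsProfile f α) {C x : ℤ} (h : f C x < α) : f (C - 1) x ≤ α := by
  obtain ⟨C', h1, -⟩ := hf.exists_first x
  rcases le_or_gt C C' with hC | hC
  · have := hf.anti x hC
    dsimp only at this
    omega
  · have := hf.anti x (show C' ≤ C - 1 by omega)
    dsimp only at this
    omega

theorem lt_iff_exists_pseudoperiod (hf : IsProfile f α) {n e : ℕ}
    (hper : ∀ C x : ℤ, f (C + n) (x + e) = f C x) (he : 1 ≤ e) {X c : ℕ → ℤ}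
    (hc : ∀ i < e, 0 ≤ c i ∧ c i < n ∧ f (c i) (X i) = α)
    (hmax : ∀ C x : ℤ, 0 ≤ C → C < n → f C x = α → x ≤ X 0)
    (hnext : ∀ i, i + 1 < e → X (i + 1) < X i ∧
      ∀ C x : ℤ, 0 ≤ C → C < n → f C x = α → x < X i → x ≤ X (i + 1))
    (hmin : ∀ i < e, ∀ C : ℤ, 0 ≤ C → C < n → f C (X i) = α → c i ≤ C) {C x : ℤ}
    (hC0 : 0 ≤ C) (hCn : C < n) (hfx : f C x = α) :
    α < f (C - 1) x ↔ ∃ i < e, X i = x ∧ c i = C := by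
  obtain ⟨hc0, hc0n, hf0⟩ := hc 0 he
  have hrange : ∀ y, X 0 - e < y → y ≤ X 0 →
      ∃ D : ℤ, 0 ≤ D ∧ D < n ∧ f D y = α ∧ α < f (D - 1) y := by
    intro y hy hy'
    obtain ⟨D, hD, hD'⟩ := hf.exists_first y
    refine ⟨D, ?_, ?_, hD, hD'⟩
    · by_contra! hneg
      have h1 := hper D y
      have h2 : f (max 0 (D + n)) (y + e) = α := by
        rcases le_total 0 (D + n) with h | h
        · rw [max_eq_right h]
          omega
        · rw [max_eq_left h]
          have h3 := hf.anti (y + e) h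
          have h4 := hf.anti (X 0) hc0
          have h5 := hf.mono 0 (show X 0 ≤ y + e by omega)
          dsimp only at h3 h4
          omega
      have := hmax _ _ (le_max_left _ _) (by omega) h2
      omega
    · by_contra! hge
      have h1 := hf.mono (c 0) hy'
      have h2 := hf.anti y (show c 0 ≤ D - 1 by omega)
      dsimp only at h2
      omega
  have hX : ∀ i < e, X i = X 0 - i := by
    intro i hi
    induction i with
    | zero => simp
    | succ i ih =>
      have hXi := ih (by omega)
      obtain ⟨D, hD, hDn, hDf, -⟩ := hrange (X 0 - (i + 1 : ℕ)) (by omega) (by omega)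
      obtain ⟨h1, h2⟩ := hnext i hi
      have := h2 D _ hD hDn hDf (by push_cast; omega)
      push_cast at this ⊢
      omega
  have hfirst : ∀ i < e, ∀ D : ℤ, 0 ≤ D → D < n → f D (X i) = α → α < f (D - 1) (X i) →
      c i = D := by
    intro i hi D hD hDn hDf hDf'
    have h1 := hmin i hi D hD hDn hDf
    by_contra hne
    have h2 := hf.anti (X i) (show c i ≤ D - 1 by omega)
    have := (hc i hi).2.2
    dsimp only at h2
    omega
  constructor
  · intro hlt
    have h1 := hmax C x hC0 hCn hfx
    have h2 : X 0 - e < x := by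
      by_contra! hle
      have h3 := hper (C - 1) x
      have h4 := hf.anti (x + e) (show c 0 ≤ C - 1 + n by omega)
      have h5 := hf.mono (c 0) (show x + e ≤ X 0 by omega)
      dsimp only at h4
      omega
    have hi : (X 0 - x).toNat < e := by omega
    have hXx : X (X 0 - x).toNat = x := by
      rw [hX _ hi]
      omega
    refine ⟨_, hi, hXx, hfirst _ hi C hC0 hCn ?_ ?_⟩ <;> rwa [hXx]
  · rintro ⟨i, hi, rfl, rfl⟩
    obtain ⟨D, hD, hDn, hDf, hDf'⟩ := hrange (X i) (by rw [hX i hi]; omega)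
      (by rw [hX i hi]; omega)
    rwa [hfirst i hi D hD hDn hDf hDf']

/-- The effect of deleting the first entry `α` of every column on the beta-sets around the
addable box above one of the deleted entries. -/
theorem peak_of_reduction (hf : IsProfile f α) {σ : ℤ → ℤ}
    (hσ : ∀ C x, f C x ≤ α → x < σ C) {g : ℤ → ℤ → ℤ}
    (hg : ∀ C x, g (C + 1) x = if α < f C x then f C x else f (C + 1) x)
    {B B' : ℤ → ℤ → Prop} (hB : ∀ C b, B C b ↔ ∃ x < σ C, f C x + x = b)
    (hB' : ∀ C b, B' (C + 1) b ↔ ∃ x < σ C, g (C + 1) x + x = b)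
    [∀ C b, Decidable (B C b)] [∀ C b, Decidable (B' C b)] {C₀ x₀ j : ℤ}
    (hj : j = x₀ + α + 1) (h0 : f C₀ x₀ = α) (h0p : α < f (C₀ - 1) x₀)
    (h0s : α < f C₀ (x₀ + 1))
    (hpeak : IsPeak (fun C => (if B C (j - 1) then 1 else 0) - if B C j then 1 else 0) C₀) :
    f (C₀ + 1) x₀ = α ∧
      IsPeak (fun C => (if B' C (j - 1) then 1 else 0) - if B' C j then 1 else 0) (C₀ + 1) := by
  obtain ⟨C₁, h1, h1p⟩ := hf.exists_first (x₀ + 1)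
  have hlt : C₀ < C₁ := by
    by_contra! hle
    have := hf.anti (x₀ + 1) hle
    dsimp only at this
    omega
  have hlow : ∀ D ≤ C₀ - 1, ∀ b, j - 1 ≤ b → b ≤ j → (B' (D + 1) b ↔ B D b) := by
    intro D hD b hb hb'
    rw [hB', hB]
    refine exists_congr fun x => and_congr_right fun hx => ?_
    rw [hg]
    have hD0 := hf.anti x₀ hD
    dsimp only at hD0
    rcases lt_trichotomy x x₀ with h | rfl | h
    · split_ifs with hα
      · rfl
      · have := hf.anti x (show D ≤ D + 1 by omega)
        dsimp only at this
        omega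
    · rw [if_pos (by omega)]
    · have := hf.mono D h.le
      rw [if_pos (by omega)]
  have hmid : ∀ D, C₀ < D → D ≤ C₁ → ∀ b, j - 1 ≤ b → b ≤ j →
      (B' D b ↔ f D x₀ = α ∧ b = j - 1) := by
    intro D hD hD' b hb hb'
    obtain ⟨D, rfl⟩ : ∃ E, D = E + 1 := ⟨D - 1, by omega⟩
    have hD0 := hf.anti x₀ (show C₀ ≤ D by omega)
    have hD1 := hf.anti (x₀ + 1) (show D ≤ C₁ - 1 by omega)
    have hDD := hf.anti x₀ (show D ≤ D + 1 by omega)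
    dsimp only at hD0 hD1 hDD
    rw [hB']
    constructor
    · rintro ⟨x, hx, hxb⟩
      rw [hg] at hxb
      rcases lt_trichotomy x x₀ with h | rfl | h
      · have := hf.mono D h.le
        have := hf.anti x (show D ≤ D + 1 by omega)
        dsimp only at this
        split_ifs at hxb <;> omega
      · split_ifs at hxb <;> omega
      · have := hf.mono D (show x₀ + 1 ≤ x by omega)
        split_ifs at hxb <;> omega
    · rintro ⟨h, rfl⟩
      refine ⟨x₀, hσ _ _ (by omega), ?_⟩
      rw [hg, if_neg (by omega)]
      omega
  have hmid' : ∀ D, C₀ < D → D ≤ C₁ → ∀ b, j - 1 ≤ b → b ≤ j →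
      (B D b ↔ (f D x₀ = α ∧ b = j - 1) ∨ (D = C₁ ∧ b = j)) := by
    intro D hD hD' b hb hb'
    have hD0 := hf.anti x₀ (show C₀ ≤ D by omega)
    dsimp only at hD0
    have hD1 : D ≠ C₁ → α < f D (x₀ + 1) := by
      intro hne
      have hD1 := hf.anti (x₀ + 1) (show D ≤ C₁ - 1 by omega)
      dsimp only at hD1
      omega
    rw [hB]
    constructor
    · rintro ⟨x, hx, hxb⟩
      rcases lt_trichotomy x x₀ with h | rfl | h
      · have := hf.mono D h.le
        omega
      · omega
      · have := hf.mono D (show x₀ + 1 ≤ x by omega)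
        by_cases hDC : D = C₁
        · subst hDC
          omega
        · have := hD1 hDC
          omega
    · rintro (⟨h, rfl⟩ | ⟨rfl, rfl⟩)
      · exact ⟨x₀, hσ _ _ (by omega), by omega⟩
      · exact ⟨x₀ + 1, hσ _ _ (by omega), by omega⟩
  have hhigh : ∀ D, C₁ < D → ∀ b, j - 1 ≤ b → b ≤ j → (B' D b ↔ B D b) := by
    intro D hD b hb hb'
    obtain ⟨D, rfl⟩ : ∃ E, D = E + 1 := ⟨D - 1, by omega⟩
    have hD1 := hf.anti (x₀ + 1) (show C₁ ≤ D by omega)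
    dsimp only at hD1
    rw [hB', hB]
    constructor
    · rintro ⟨x, hx, hxb⟩
      rw [hg] at hxb
      split_ifs at hxb with hα
      · exfalso
        rcases le_or_gt x (x₀ + 1) with h | h
        · have := hf.mono D h
          omega
        · omega
      · have := hf.anti x (show D ≤ D + 1 by omega)
        dsimp only at this
        exact ⟨x, hσ _ _ (by omega), hxb⟩
    · rintro ⟨x, hx, hxb⟩
      have hle : f D x ≤ α := by
        rcases le_or_gt x (x₀ + 1) with h | h
        · have := hf.mono D h
          omega
        · have := hf.le_of_lt (C := D + 1) (x := x) (by omega)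
          rwa [add_sub_cancel_right] at this
      exact ⟨x, hσ _ _ hle, by rw [hg, if_neg (by omega)]; exact hxb⟩
  have hj1 : ∀ D, C₀ < D → D ≤ C₁ → (B' D (j - 1) ↔ f D x₀ = α) := by
    intro D hD hD'
    rw [hmid D hD hD' _ le_rfl (by omega)]
    simp
  have hj0 : ∀ D, C₀ < D → D ≤ C₁ → ¬ B' D j := by
    intro D hD hD'
    rw [hmid D hD hD' _ (by omega) le_rfl]
    omega
  let L' : ℤ → ℤ := fun C => (if B' C (j - 1) then 1 else 0) - if B' C j then 1 else 0
  obtain ⟨hone, hres⟩ : L' (C₀ + 1) = 1 ∧ IsPeak L' (C₀ + 1) := by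
    refine hpeak.of_shift hlt ?_ ?_ ?_ ?_ <;> simp only [L']
    · intro D hD
      have h1 := hlow (D - 1) (by omega) (j - 1) (by omega) (by omega)
      have h2 := hlow (D - 1) (by omega) j (by omega) (by omega)
      rw [sub_add_cancel] at h1 h2
      simp only [h1, h2]
    · intro D hD
      rcases le_or_gt D C₁ with hD' | hD'
      · have h1 := hmid' D hD hD' (j - 1) (by omega) (by omega)
        have h2 := hmid' D hD hD' j (by omega) (by omega)
        simp only [and_true, show j - 1 ≠ j by omega, and_false, or_false] at h1
        simp only [and_true, show j ≠ j - 1 by omega, and_false, false_or] at h2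
        simp only [hj1 D hD hD', hj0 D hD hD', h1, h2, if_false]
        omega
      · simp only [hhigh D hD' (j - 1) (by omega) (by omega), hhigh D hD' j (by omega) (by omega),
          if_neg hD'.ne', add_zero]
    · intro D hD hD'
      simp only [hj1 D hD hD', hj0 D hD hD', hj1 (C₀ + 1) (by omega) (by omega),
        hj0 (C₀ + 1) (by omega) (by omega), if_false, sub_zero]
      have h2 := hf.anti x₀ (show C₀ ≤ C₀ + 1 by omega)
      have h3 := hf.anti x₀ (show C₀ + 1 ≤ D by omega)
      dsimp only at h2 h3
      split_ifs <;> omega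
    · simp only [hj0 (C₀ + 1) (by omega) (by omega), if_false, sub_zero]
      split_ifs <;> omega
  refine ⟨?_, hres⟩
  simp only [L', if_neg (hj0 _ (show C₀ < C₀ + 1 by omega) (by omega))] at hone
  rw [← hj1 _ (by omega) (by omega)]
  by_contra hcon
  simp [if_neg hcon] at hone

end IsProfile

theorem succ_cases (l : ℕ) (C : ℤ) :
    (∃ (c : Fin l) (q : ℤ), C = c.castSucc.val + (l + 1) * q ∧
      C + 1 = c.succ.val + (l + 1) * q) ∨
    ∃ q : ℤ, C = (Fin.last l).val + (l + 1) * q ∧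
      C + 1 = (0 : Fin (l + 1)).val + (l + 1) * (q + 1) := by
  obtain ⟨c, q, rfl⟩ := exists_eq_add_mul l C
  induction c using Fin.lastCases with
  | last =>
    right
    refine ⟨q, rfl, ?_⟩
    simp only [Fin.val_last, Fin.val_zero, Nat.cast_zero]
    ring
  | cast c =>
    left
    refine ⟨c, q, rfl, ?_⟩
    simp only [Fin.val_castSucc, Fin.val_succ]
    push_cast
    ring

theorem rho_castSucc (c : Fin l) : rho l c.castSucc = c.succ := by
  simp [rho]

theorem rho_last (l : ℕ) : rho l (Fin.last l) = 0 := by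
  simp [rho]

theorem compOf_succ (l : ℕ) (C : ℤ) : compOf l (C + 1) = rho l (compOf l C) := by
  rcases succ_cases l C with ⟨c, q, h, h'⟩ | ⟨q, h, h'⟩
  · rw [h', h, compOf_add_mul, compOf_add_mul, rho_castSucc]
  · rw [h', h, compOf_add_mul, compOf_add_mul, rho_last]

section Extended

variable {e : ℕ} {s : Fin (l + 1) → ℤ} {Λ : MultiPartition l}

theorem extCharge_xiCharge_succ (e : ℕ) (s : Fin (l + 1) → ℤ) (C : ℤ) :
    extCharge e (xiCharge e s) (C + 1) = extCharge e s C := by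
  rcases succ_cases l C with ⟨c, q, h, h'⟩ | ⟨q, h, h'⟩
  · rw [h', h, extCharge_add_mul, extCharge_add_mul, xiCharge, ← rho_castSucc,
      Equiv.symm_apply_apply, rho_castSucc, if_neg (Fin.succ_ne_zero c), sub_zero]
  · rw [h', h, extCharge_add_mul, extCharge_add_mul, xiCharge, if_pos rfl]
    rw [show (rho l).symm 0 = Fin.last l by rw [← rho_last, Equiv.symm_apply_apply]]
    ring

theorem InSe.extCharge_le_succ (hs : InSe e s) (C : ℤ) :
    extCharge e s C ≤ extCharge e s (C + 1) := by
  rcases succ_cases l C with ⟨c, q, h, h'⟩ | ⟨q, h, h'⟩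
  · rw [h', h, extCharge_add_mul, extCharge_add_mul]
    have := (hs c.castSucc c.succ (Fin.castSucc_lt_succ)).1
    omega
  · rw [h', h, extCharge_add_mul, extCharge_add_mul, mul_add]
    rcases Nat.eq_zero_or_pos l with rfl | hl
    · have : s (Fin.last 0) = s 0 := rfl
      omega
    · have := (hs 0 (Fin.last l) (by rw [Fin.lt_def]; simpa using hl)).2
      omega

theorem Cylindric.part_le_s15 (hcyl : Cylindric e s Λ) (C : ℤ) {a : ℕ} (ha : 1 ≤ a) :
    (Λ (compOf l (C + 1))).part (a + (extCharge e s (C + 1) - extCharge e s C).toNat) ≤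
      (Λ (compOf l C)).part a := by
  rcases succ_cases l C with ⟨c, q, h, h'⟩ | ⟨q, h, h'⟩
  · rw [h', h, compOf_add_mul, compOf_add_mul, extCharge_add_mul, extCharge_add_mul,
      add_sub_add_right_eq_sub]
    exact hcyl.1 c a ha
  · rw [h', h, compOf_add_mul, compOf_add_mul, extCharge_add_mul, extCharge_add_mul,
      show s 0 + e * (q + 1) - (s (Fin.last l) + e * q) = (e : ℤ) + s 0 - s (Fin.last l) by ring]
    exact hcyl.2 a ha

/-- The parts of the periodically extended multipartition, indexed by the position
`s_C - a`; positions that are not those of a row get the value `K`. -/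
def extPart (e : ℕ) (s : Fin (l + 1) → ℤ) (Λ : MultiPartition l) (K C x : ℤ) : ℤ :=
  if x < extCharge e s C then (Λ (compOf l C)).part (extCharge e s C - x).toNat else K

theorem extPart_row (e : ℕ) (s : Fin (l + 1) → ℤ) (Λ : MultiPartition l) (K C : ℤ) {a : ℕ}
    (ha : 1 ≤ a) : extPart e s Λ K C (extCharge e s C - a) = (Λ (compOf l C)).part a := by
  rw [extPart, if_pos (by omega), sub_sub_cancel, Int.toNat_natCast]

theorem extPart_of_le (Λ : MultiPartition l) (K : ℤ) {C x : ℤ} (h : extCharge e s C ≤ x) :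
    extPart e s Λ K C x = K := if_neg (by omega)

theorem extPart_period (e : ℕ) (s : Fin (l + 1) → ℤ) (Λ : MultiPartition l) (K C x q : ℤ) :
    extPart e s Λ K (C + (l + 1) * q) (x + e * q) = extPart e s Λ K C x := by
  obtain ⟨c, r, rfl⟩ := exists_eq_add_mul l C
  rw [add_assoc, ← mul_add]
  simp only [extPart, extCharge_add_mul, compOf_add_mul]
  rw [show s c + e * (r + q) - (x + e * q) = s c + e * r - x by ring, mul_add, ← add_assoc]
  simp only [add_lt_add_iff_right]

theorem isBead_iff_extPart (e : ℕ) (s : Fin (l + 1) → ℤ) (Λ : MultiPartition l) (K C b : ℤ) :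
    IsBead e s Λ C b ↔ ∃ x < extCharge e s C, extPart e s Λ K C x + x = b := by
  constructor
  · rintro ⟨a, ha, rfl⟩
    refine ⟨extCharge e s C - a, by omega, ?_⟩
    rw [extPart_row e s Λ K C ha]
    ring
  · rintro ⟨x, hx, rfl⟩
    refine ⟨(extCharge e s C - x).toNat, by omega, ?_⟩
    rw [extPart, if_pos hx, Int.toNat_of_nonneg (by omega)]
    ring

theorem rightmostAt_iff_extPart {K : ℤ} {α : ℕ} (hα : (α : ℤ) < K) (C x : ℤ) :
    RightmostAt Λ α ⟨(extCharge e s C - x).toNat, α, compOf l C⟩ ↔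
      extPart e s Λ K C x = α := by
  simp only [RightmostAt, extPart]
  split_ifs with h
  · simp only [true_and, Nat.cast_inj]
    exact ⟨fun h => h.2, fun h' => ⟨by omega, h'⟩⟩
  · exact ⟨fun h' => by omega, fun h' => by omega⟩

theorem isProfile_extPart {K : ℤ} {α : ℕ} (he : 1 ≤ e) (hs : InSe e s)
    (hcyl : Cylindric e s Λ) (hcov : Covers e s Λ α)
    (hK : ∀ c a, ((Λ c).part a : ℤ) < K) (hα : (α : ℤ) < K) :
    IsProfile (extPart e s Λ K) α := by
  have hmono : ∀ C, Monotone (extPart e s Λ K C) := by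
    intro C x y hxy
    by_cases hy : y < extCharge e s C
    · rw [extPart, extPart, if_pos hy, if_pos (by omega)]
      exact_mod_cast (Λ _).part_le_part (by omega) (by omega)
    · rw [extPart_of_le Λ K (not_lt.1 hy), extPart]
      split_ifs
      · exact (hK _ _).le
      · exact le_rfl
  have hanti : ∀ x, Antitone fun C => extPart e s Λ K C x := by
    intro x
    refine antitone_int_of_succ_le fun C => ?_
    have hle := hs.extCharge_le_succ C
    by_cases hx : x < extCharge e s C
    · rw [extPart, extPart, if_pos hx, if_pos (by omega)]
      have := hcyl.part_le_s15 C (a := (extCharge e s C - x).toNat) (by omega)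
      rw [show (extCharge e s C - x).toNat + (extCharge e s (C + 1) - extCharge e s C).toNat =
        (extCharge e s (C + 1) - x).toNat by omega] at this
      exact_mod_cast this
    · rw [extPart_of_le Λ K (not_lt.1 hx), extPart]
      split_ifs
      · exact (hK _ _).le
      · exact le_rfl
  refine ⟨hmono, hanti, fun x => ?_⟩
  have he' : (0 : ℤ) < e := by omega
  obtain ⟨γ, ⟨hrow, hcol, hpart⟩, hγ⟩ := hcov ((x + α) % e) (Int.emod_nonneg _ (by omega))
    (Int.emod_lt_of_pos _ he')
  obtain ⟨k, hk⟩ : (e : ℤ) ∣ x + α - content s γ :=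
    Int.ModEq.dvd hγ
  obtain ⟨C, hC⟩ : ∃ C, extPart e s Λ K C x = α := by
    refine ⟨γ.comp.val + (l + 1) * k, ?_⟩
    have hx : x = extCharge e s (γ.comp.val + (l + 1) * k) - γ.row := by
      rw [extCharge_add_mul]
      simp only [content, hcol] at hk
      linarith
    rw [hx, extPart_row _ _ _ _ _ hrow, compOf_add_mul, hpart]
  have hbdd : ∃ b : ℤ, ∀ z, extPart e s Λ K z x ≤ α → b ≤ z := by
    set k : ℕ := (extCharge e s C - x).toNat with hkdef
    refine ⟨C + (l + 1) * (-k), fun z hz => ?_⟩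
    by_contra! hlt
    have h1 := hanti x hlt.le
    have h2 := extPart_period e s Λ K C (x + e * k) (-k)
    rw [mul_neg (e : ℤ), add_neg_cancel_right] at h2
    have h3 : (k : ℤ) ≤ e * k := by nlinarith
    rw [extPart_of_le Λ K (C := C) (x := x + e * k) (by omega)] at h2
    dsimp only at h1
    omega
  obtain ⟨D, hD, hmin⟩ := Int.exists_least_of_bdd hbdd ⟨C, hC.le⟩
  have hDC := hanti x (hmin C hC.le)
  dsimp only at hDC
  refine ⟨D, by omega, ?_⟩
  by_contra! hle
  have := hmin _ hle
  omega

theorem inPseudo_iff_extPart {K : ℤ} {α : ℕ} {P : ℕ → Node l} (he : 1 ≤ e) (hs : InSe e s)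
    (hcyl : Cylindric e s Λ) (hP : IsFirstPseudoperiod e s Λ α P)
    (hK : ∀ c a, ((Λ c).part a : ℤ) < K) (hα : (α : ℤ) < K) {C x : ℤ}
    (hx : extPart e s Λ K C x = α) :
    InPseudo e P ⟨(extCharge e s C - x).toNat, α, compOf l C⟩ ↔
      α < extPart e s Λ K (C - 1) x := by
  obtain ⟨-, hcov, -, hright, hmax, hmin0, hnext⟩ := hP
  have hf := isProfile_extPart he hs hcyl hcov hK hα
  have hzero : ∀ c : Fin (l + 1), extCharge e s c.val = s c ∧ compOf l c.val = c := by
    intro c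
    have h1 := extCharge_add_mul e s c 0
    have h2 := compOf_add_mul c 0
    simp only [mul_zero, add_zero] at h1 h2
    exact ⟨h1, h2⟩
  -- reduction to components in the fundamental domain
  obtain ⟨c, q, rfl⟩ := exists_eq_add_mul l C
  have hxq := extPart_period e s Λ K c.val (x - e * q) q
  have hxq' := extPart_period e s Λ K (c.val - 1) (x - e * q) q
  rw [sub_add_cancel] at hxq hxq'
  rw [show (c.val : ℤ) + (l + 1) * q - 1 = c.val - 1 + (l + 1) * q by ring, hxq',
    extCharge_add_mul, compOf_add_mul]
  rw [hxq] at hx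
  rw [show s c + e * q - x = s c - (x - e * q) by ring]
  generalize x - e * q = y at *
  clear hxq hxq'
  have hnode : ∀ (D z : ℤ), 0 ≤ D → D < (l + 1 : ℕ) → extPart e s Λ K D z = α →
      ∃ γ : Node l, RightmostAt Λ α γ ∧ content s γ = α + z ∧ (γ.comp.val : ℤ) = D := by
    intro D z hD hDl hz
    have h1 := (rightmostAt_iff_extPart (e := e) (s := s) hα D z).2 hz
    obtain ⟨d, rfl⟩ : ∃ d : Fin (l + 1), D = d.val := ⟨⟨D.toNat, by omega⟩, by simp [hD]⟩
    refine ⟨_, h1, ?_, by rw [(hzero d).2]⟩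
    have := h1.1
    simp only [content, (hzero d).1, (hzero d).2] at this ⊢
    omega
  have hval : ∀ γ : Node l, RightmostAt Λ α γ →
      extPart e s Λ K γ.comp.val (content s γ - α) = α := by
    intro γ ⟨h1, h2, h3⟩
    have := extPart_row e s Λ K γ.comp.val h1
    rw [(hzero _).1, (hzero _).2, h3] at this
    have hx' : content s γ - α = s γ.comp - γ.row := by
      simp only [content, h2]
      ring
    rwa [hx']
  have key := hf.lt_iff_exists_pseudoperiod (n := l + 1) (e := e) (X := fun i => content s (P i) - α)
    (c := fun i => (P i).comp.val) (C := c.val) (x := y) ?_ he ?_ ?_ ?_ ?_ (by omega)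
    (by have := c.isLt; omega) hx
  · rw [key]
    have hyc : y < s c := by
      by_contra! hle
      rw [extPart_of_le Λ K (by rw [(hzero c).1]; exact hle)] at hx
      omega
    refine exists_congr fun i => and_congr_right fun hi => ?_
    obtain ⟨h1, h2, h3⟩ := hright i hi
    rcases hPi : P i with ⟨a, b, d⟩
    rw [hPi] at h1 h2 h3
    dsimp only at h1 h2
    simp only [Node.mk.injEq, content]
    constructor
    · rintro ⟨rfl, -, rfl⟩
      refine ⟨?_, rfl⟩
      rw [h2, Int.toNat_of_nonneg (by omega)]
      ring
    · rintro ⟨hy, hd⟩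
      obtain rfl : d = c := Fin.ext (by exact_mod_cast hd)
      exact ⟨by omega, h2, rfl⟩
  · intro D z
    simpa using extPart_period e s Λ K D z 1
  · intro i hi
    have := (P i).comp.isLt
    exact ⟨by omega, by omega, hval _ (hright i hi)⟩
  · intro D z hD hDl hz
    obtain ⟨γ, hγ, hcont, -⟩ := hnode D z hD hDl hz
    have := hmax γ hγ
    omega
  · intro i hi
    obtain ⟨h1, h2, -⟩ := hnext i hi
    refine ⟨by omega, fun D z hD hDl hz hlt => ?_⟩
    obtain ⟨γ, hγ, hcont, -⟩ := hnode D z hD hDl hz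
    have := h2 γ hγ (by omega)
    omega
  · intro i hi D hD hDl hz
    obtain ⟨γ, hγ, hcont, rfl⟩ := hnode D _ hD hDl hz
    have hcont' : content s γ = content s (P i) := by omega
    rcases i with _ | i
    · exact_mod_cast hmin0 γ hγ hcont'
    · exact_mod_cast (hnext i hi).2.2 γ hγ hcont'

end Extended

theorem Partition.finite_le_part (π : Partition) {v : ℕ} (hv : 1 ≤ v) :
    {a : ℕ | 1 ≤ a ∧ v ≤ π.part a}.Finite := by
  obtain ⟨N, hN⟩ := π.eventually_zero
  refine (Set.finite_lt_nat N).subset fun a ⟨_, ha⟩ => ?_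
  by_contra! h
  have := hN a (not_lt.1 h)
  omega

theorem Partition.le_part_iff (π : Partition) {v a : ℕ} (hv : 1 ≤ v) (ha : 1 ≤ a) :
    v ≤ π.part a ↔ a ≤ {b : ℕ | 1 ≤ b ∧ v ≤ π.part b}.ncard := by
  have hcard : ∀ n : ℕ, (Set.Icc 1 n).ncard = n := fun n => by
    rw [← Finset.coe_Icc, Set.ncard_coe_finset, Nat.card_Icc, Nat.add_sub_cancel]
  constructor
  · intro h
    rw [← hcard a]
    exact Set.ncard_le_ncard
      (fun b hb => ⟨hb.1, h.trans (π.part_le_part hb.1 hb.2)⟩) (π.finite_le_part hv)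
  · intro h
    by_contra hlt
    have hsub : {b : ℕ | 1 ≤ b ∧ v ≤ π.part b} ⊆ Set.Icc 1 (a - 1) := by
      rintro b ⟨hb, hvb⟩
      refine ⟨hb, ?_⟩
      by_contra hab
      exact hlt (hvb.trans (π.part_le_part ha (by omega)))
    have := Set.ncard_le_ncard hsub (Set.finite_Icc _ _)
    rw [hcard] at this
    omega

theorem countParts_eq_ncard (π : Partition) (v : ℕ) :
    countParts π v = {a : ℕ | 1 ≤ a ∧ π.part a = v}.ncard := rfl

theorem Partition.ncard_le_part (π : Partition) {v : ℕ} (hv : 1 ≤ v) :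
    {a : ℕ | 1 ≤ a ∧ v ≤ π.part a}.ncard =
      {a : ℕ | 1 ≤ a ∧ v + 1 ≤ π.part a}.ncard + countParts π v := by
  have hunion : {a : ℕ | 1 ≤ a ∧ v ≤ π.part a} =
      {a : ℕ | 1 ≤ a ∧ v + 1 ≤ π.part a} ∪ {a : ℕ | 1 ≤ a ∧ π.part a = v} := by
    ext a
    simp only [Set.mem_ofPred_eq, Set.mem_union]
    omega
  rw [hunion, countParts_eq_ncard]
  refine Set.ncard_union_eq ?_ (π.finite_le_part (by omega)) ((π.finite_le_part hv).subset ?_)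
  · rw [Set.disjoint_left]
    rintro a ⟨_, h⟩ ⟨_, h'⟩
    omega
  · rintro a ⟨h, h'⟩
    exact ⟨h, h'.ge⟩

/-- A partition is determined by its part multiplicities. -/
theorem Partition.part_eq_of_countParts_eq {π ν : Partition}
    (h : ∀ v, 1 ≤ v → countParts π v = countParts ν v) {a : ℕ} (ha : 1 ≤ a) :
    π.part a = ν.part a := by
  have hempty : ∀ (ρ : Partition) (v : ℕ), ρ.part 1 < v →
      {a : ℕ | 1 ≤ a ∧ v ≤ ρ.part a} = ∅ := by
    intro ρ v hv
    rw [Set.eq_empty_iff_forall_notMem]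
    rintro a ⟨ha, hva⟩
    have := ρ.part_le_part le_rfl ha
    omega
  have hcard : ∀ k v, 1 ≤ v → max (π.part 1) (ν.part 1) < v + k →
      {a : ℕ | 1 ≤ a ∧ v ≤ π.part a}.ncard = {a : ℕ | 1 ≤ a ∧ v ≤ ν.part a}.ncard := by
    intro k
    induction k with
    | zero =>
      intro v _ hv
      rw [hempty π v (by omega), hempty ν v (by omega)]
    | succ k ih =>
      intro v hv hlt
      rw [π.ncard_le_part hv, ν.ncard_le_part hv, h v hv, ih (v + 1) (by omega) (by omega)]
  have hiff : ∀ v, 1 ≤ v → (v ≤ π.part a ↔ v ≤ ν.part a) := by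
    intro v hv
    rw [π.le_part_iff hv ha, ν.le_part_iff hv ha,
      hcard (max (π.part 1) (ν.part 1) + 1) v hv (by omega)]
  apply le_antisymm
  · rcases Nat.eq_zero_or_pos (π.part a) with h0 | h0
    · omega
    · exact (hiff _ h0).1 le_rfl
  · rcases Nat.eq_zero_or_pos (ν.part a) with h0 | h0
    · omega
    · exact (hiff _ h0).2 le_rfl

/-- The parts of `π` greater than `α`, followed by the parts of `ν` shifted by `d`. -/
def Partition.splice (π ν : Partition) (α d : ℕ)
    (h : ∀ a, 1 ≤ a → ν.part (a + d) ≤ π.part a) : Partition where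
  part a := if a = 0 then 0 else if α < π.part a then π.part a else ν.part (a + d)
  part_zero := rfl
  antitone a ha := by
    have h1 := π.antitone a ha
    have h2 := ν.antitone (a + d) (by omega)
    have h3 := h (a + 1) (by omega)
    rw [show a + 1 + d = a + d + 1 by omega] at *
    split_ifs <;> omega
  eventually_zero := by
    obtain ⟨N, hN⟩ := π.eventually_zero
    obtain ⟨M, hM⟩ := ν.eventually_zero
    refine ⟨max N M, fun a ha => ?_⟩
    rw [hN a (by omega), hM (a + d) (by omega)]
    simp

theorem Partition.splice_part {π ν : Partition} {α d : ℕ}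
    (h : ∀ a, 1 ≤ a → ν.part (a + d) ≤ π.part a) {a : ℕ} (ha : 1 ≤ a) :
    (π.splice ν α d h).part a = if α < π.part a then π.part a else ν.part (a + d) :=
  if_neg (by omega)

section Reduction

variable {e : ℕ} {s : Fin (l + 1) → ℤ} {Λ μ : MultiPartition l} {α : ℕ} {P : ℕ → Node l}

theorem IsFirstPseudoperiod.content_lt (hP : IsFirstPseudoperiod e s Λ α P) {i j : ℕ}
    (hij : i < j) (hj : j < e) : content s (P j) < content s (P i) := by
  induction j, hij using Nat.le_induction with
  | base => exact (hP.2.2.2.2.2.2 i hj).1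
  | succ j _ ih => exact (hP.2.2.2.2.2.2 j hj).1.trans (ih (by omega))

theorem IsFirstPseudoperiod.nalP_eq_ncard (hP : IsFirstPseudoperiod e s Λ α P)
    (c : Fin (l + 1)) : NalP e P c = {b : ℕ | InPseudo e P ⟨b, α, c⟩}.ncard := by
  have himage : {b : ℕ | InPseudo e P ⟨b, α, c⟩} =
      (fun i => (P i).row) '' {i : ℕ | i < e ∧ (P i).comp = c} := by
    ext b
    constructor
    · rintro ⟨i, hi, h⟩
      exact ⟨i, ⟨hi, by rw [h]⟩, by simp only [h]⟩
    · rintro ⟨i, ⟨hi, hc⟩, rfl⟩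
      refine ⟨i, hi, ?_⟩
      have := (hP.2.2.2.1 i hi).2.1
      rcases hPi : P i with ⟨x, y, z⟩
      simp_all
  rw [himage, Set.InjOn.ncard_image]
  · rfl
  · intro i ⟨hi, hic⟩ j ⟨hj, hjc⟩ hij
    have hcont : content s (P i) = content s (P j) := by
      have h1 := (hP.2.2.2.1 i hi).2.1
      have h2 := (hP.2.2.2.1 j hj).2.1
      simp only at hij
      simp only [content, h1, h2, hic, hjc, hij]
    rcases lt_trichotomy i j with h | h | h
    · exact absurd hcont (hP.content_lt h hj).ne'
    · exact h
    · exact absurd hcont (hP.content_lt h hi).ne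

theorem prevComp_compOf_succ (l : ℕ) (C : ℤ) : prevComp (compOf l (C + 1)) = compOf l C := by
  rw [compOf_succ, prevComp, Equiv.symm_apply_apply]

theorem IsPsi.part_compOf_succ {K : ℤ} (he : 1 ≤ e) (hs : InSe e s) (hcyl : Cylindric e s Λ)
    (hP : IsFirstPseudoperiod e s Λ α P) (hμ : IsPsi e P α Λ μ)
    (hK : ∀ c a, ((Λ c).part a : ℤ) < K) (hα : (α : ℤ) < K) (C : ℤ) {a : ℕ} (ha : 1 ≤ a) :
    (μ (compOf l (C + 1))).part a =
      if α < (Λ (compOf l C)).part a then (Λ (compOf l C)).part a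
      else (Λ (compOf l (C + 1))).part (a + (extCharge e s (C + 1) - extCharge e s C).toNat) := by
  have hf := isProfile_extPart he hs hcyl hP.2.1 hK hα
  have hle := hs.extCharge_le_succ C
  set d := (extCharge e s (C + 1) - extCharge e s C).toNat with hd
  set p := Λ (compOf l C) with hp
  set q := Λ (compOf l (C + 1)) with hq
  have hpq : ∀ a, 1 ≤ a → q.part (a + d) ≤ p.part a := fun a ha => hcyl.part_le_s15 C ha
  rw [← Partition.splice_part hpq ha]
  refine Partition.part_eq_of_countParts_eq (fun v hv => ?_) ha
  rw [hμ _ v hv, prevComp_compOf_succ, ← hp]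
  have hsmall : ∀ b : ℕ, 1 ≤ b → extPart e s Λ K C (extCharge e s (C + 1) - b) ≤ α →
      d < b ∧ p.part (b - d) ≤ α := by
    intro b hb h
    rw [extPart] at h
    split_ifs at h with hlt
    · rw [show (extCharge e s C - (extCharge e s (C + 1) - b)).toNat = b - d by omega] at h
      exact ⟨by omega, by exact_mod_cast h⟩
    · omega
  have hsmall' : ∀ b : ℕ, 1 ≤ b → p.part b ≤ α →
      extPart e s Λ K C (extCharge e s (C + 1) - (b + d : ℕ)) ≤ α := by
    intro b hb h
    rw [show extCharge e s (C + 1) - (b + d : ℕ) = extCharge e s C - b by omega,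
      extPart_row _ _ _ _ _ hb]
    exact_mod_cast h
  have hcount : v ≤ α → countParts (p.splice q α d hpq) v =
      {b : ℕ | (1 ≤ b ∧ q.part b = v) ∧
        extPart e s Λ K C (extCharge e s (C + 1) - b) ≤ α}.ncard := by
    intro hvα
    rw [countParts_eq_ncard, ← Set.ncard_image_of_injective _ (add_left_injective d)]
    congr 1
    ext b
    constructor
    · rintro ⟨a, ⟨ha, hav⟩, rfl⟩
      rw [Partition.splice_part hpq ha] at hav
      split_ifs at hav with hpa
      · omega
      · exact ⟨⟨by dsimp only; omega, hav⟩, hsmall' a ha (not_lt.1 hpa)⟩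
    · rintro ⟨⟨hb, hbv⟩, hext⟩
      obtain ⟨hdb, hpb⟩ := hsmall b hb hext
      refine ⟨b - d, ⟨by omega, ?_⟩, by dsimp only; omega⟩
      rw [Partition.splice_part hpq (by omega), if_neg (by omega), Nat.sub_add_cancel hdb.le, hbv]
  have hrow : ∀ b : ℕ, 1 ≤ b → extPart e s Λ K (C + 1) (extCharge e s (C + 1) - b) = q.part b :=
    fun b hb => extPart_row _ _ _ _ _ hb
  split_ifs with h1 h2
  · rw [hcount h1.le, countParts_eq_ncard]
    congr 1
    ext b
    refine ⟨fun h => ⟨h, ?_⟩, fun h => h.1⟩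
    have := hf.le_of_lt (C := C + 1) (x := extCharge e s (C + 1) - b)
      (by rw [hrow b h.1, h.2]; exact_mod_cast h1)
    rwa [add_sub_cancel_right] at this
  · subst h2
    have hiff : ∀ b : ℕ, 1 ≤ b → q.part b = v → (InPseudo e P ⟨b, v, compOf l (C + 1)⟩ ↔
        v < extPart e s Λ K C (extCharge e s (C + 1) - b)) := by
      intro b hb hbv
      have := inPseudo_iff_extPart he hs hcyl hP hK hα (C := C + 1)
        (x := extCharge e s (C + 1) - b) (by rw [hrow b hb, hbv])
      rwa [sub_sub_cancel, Int.toNat_natCast, add_sub_cancel_right] at this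
    have hsub : {b : ℕ | InPseudo e P ⟨b, v, compOf l (C + 1)⟩} ⊆
        {b : ℕ | 1 ≤ b ∧ q.part b = v} := by
      rintro b ⟨i, hi, hPi⟩
      have := hP.2.2.2.1 i hi
      rw [hPi] at this
      exact ⟨this.1, this.2.2⟩
    have hfin : {b : ℕ | 1 ≤ b ∧ q.part b = v}.Finite :=
      (q.finite_le_part hv).subset fun b hb => ⟨hb.1, hb.2.ge⟩
    rw [hcount le_rfl, hP.nalP_eq_ncard, countParts_eq_ncard,
      ← Set.ncard_sdiff hsub (hfin.subset hsub)]
    congr 1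
    ext b
    simp only [Set.mem_sdiff, Set.mem_ofPred_eq]
    refine and_congr_right fun h => ?_
    rw [hiff b h.1 h.2, not_lt]
  · rw [countParts_eq_ncard, countParts_eq_ncard]
    congr 1
    ext b
    simp only [Set.mem_ofPred_eq]
    refine and_congr_right fun hb => ?_
    rw [Partition.splice_part hpq hb]
    split_ifs with hpb
    · rfl
    · have := hpq b hb
      omega

theorem IsPsi.extPart_succ {K : ℤ} (he : 1 ≤ e) (hs : InSe e s) (hcyl : Cylindric e s Λ)
    (hP : IsFirstPseudoperiod e s Λ α P) (hμ : IsPsi e P α Λ μ)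
    (hK : ∀ c a, ((Λ c).part a : ℤ) < K) (hα : (α : ℤ) < K) (C x : ℤ) :
    extPart e (xiCharge e s) μ K (C + 1) x =
      if α < extPart e s Λ K C x then extPart e s Λ K C x else extPart e s Λ K (C + 1) x := by
  have hle := hs.extCharge_le_succ C
  rw [extPart, extCharge_xiCharge_succ]
  by_cases hx : x < extCharge e s C
  · rw [if_pos hx, hμ.part_compOf_succ he hs hcyl hP hK hα C (by omega), extPart, extPart,
      if_pos hx, if_pos (show x < extCharge e s (C + 1) by omega),
      show (extCharge e s C - x).toNat + (extCharge e s (C + 1) - extCharge e s C).toNat =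
        (extCharge e s (C + 1) - x).toNat by omega]
    push_cast
    simp only [Nat.cast_lt]
  · rw [if_neg hx, extPart_of_le Λ K (not_lt.1 hx), if_pos hα]

theorem MultiPartition.exists_part_lt (Λ : MultiPartition l) (α : ℕ) :
    ∃ K : ℤ, (∀ c a, ((Λ c).part a : ℤ) < K) ∧ (α : ℤ) < K := by
  refine ⟨(∑ c, (Λ c).part 1 + α + 1 : ℕ), fun c a => ?_, by omega⟩
  have h1 := Finset.single_le_sum (f := fun c => (Λ c).part 1) (fun _ _ => Nat.zero_le _)
    (Finset.mem_univ c)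
  have h2 : (Λ c).part a ≤ (Λ c).part 1 := by
    rcases Nat.eq_zero_or_pos a with rfl | ha
    · rw [(Λ c).part_zero]
      exact Nat.zero_le _
    · exact (Λ c).part_le_part le_rfl ha
  omega

end Reduction

/-!
STATEMENT 15 (Lemma 5.1 of the paper): if γ⁺ = (a, α+1, c) is the good addable i-node
of (λ, s) with γ = (a, α, c) in the first pseudoperiod P(λ), then the good addable
i-node of (ψ(λ), ξ(s)) is Δ⁺ = (a, α+1, c+1) for c < l, and Δ⁺ = (a, α+1, 1) for
c = l (i.e. the component index is rotated by ρ).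
-/
theorem good_addable_node_of_reduction_pseudoperiod_case
    (l e : ℕ) (he : 2 ≤ e) (s : Fin (l + 1) → ℤ) (Λ μ : MultiPartition l)
    (α : ℕ) (P : ℕ → Node l) (i : ℕ) (hi : i < e)
    (hs : InSe e s) (hcyl : Cylindric e s Λ) (hnf : ¬ FLOTW e s Λ)
    (hP : IsFirstPseudoperiod e s Λ α P)
    (hμ : IsPsi e P α Λ μ)
    (a : ℕ) (c : Fin (l + 1))
    (hmem : InPseudo e P ⟨a, α, c⟩)
    (hgood : GoodAddable Λ s e (i : ℤ) ⟨a, α + 1, c⟩) :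
    GoodAddable μ (xiCharge e s) e (i : ℤ) ⟨a, α + 1, rho l c⟩ := by
  classical
  have he1 : 1 ≤ e := by omega
  have hi0 : (0 : ℤ) ≤ i := by omega
  have hie : (i : ℤ) < e := by omega
  obtain ⟨K, hK, hα⟩ := Λ.exists_part_lt α
  have hf := isProfile_extPart he1 hs hcyl hP.2.1 hK hα
  obtain ⟨⟨ha, hcol, hprev⟩, hres, hpeak⟩ := (goodAddable_iff hi0 hie _).1 hgood
  have hcomp := compOf_key e s ⟨a, α + 1, c⟩
  have hj := col_sub_row_add_extCharge hres
  set C₀ := key e s ⟨a, α + 1, c⟩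
  dsimp only at ha hcol hprev hcomp hj
  push_cast at hj
  have hpart : (Λ c).part a = α := by omega
  have h0 : extPart e s Λ K C₀ (extCharge e s C₀ - a) = α := by
    rw [extPart_row _ _ _ _ _ ha, hcomp, hpart]
  have h0p : α < extPart e s Λ K (C₀ - 1) (extCharge e s C₀ - a) := by
    rw [← inPseudo_iff_extPart he1 hs hcyl hP hK hα h0, sub_sub_cancel, Int.toNat_natCast, hcomp]
    exact hmem
  have h0s : α < extPart e s Λ K C₀ (extCharge e s C₀ - a + 1) := by
    rcases hprev with rfl | hprev
    · rwa [extPart_of_le Λ K (by omega)]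
    · have ha1 : a ≠ 1 := by
        rintro rfl
        rw [(Λ c).part_zero] at hprev
        omega
      rw [show extCharge e s C₀ - a + 1 = extCharge e s C₀ - (a - 1 : ℕ) by omega,
        extPart_row _ _ _ _ _ (by omega), hcomp]
      omega
  have hσ : ∀ C x, extPart e s Λ K C x ≤ α → x < extCharge e s C := by
    intro C x h
    by_contra! hx
    rw [extPart_of_le Λ K hx] at h
    omega
  have hB' : ∀ C b, IsBead e (xiCharge e s) μ (C + 1) b ↔
      ∃ x < extCharge e s C, extPart e (xiCharge e s) μ K (C + 1) x + x = b := by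
    intro C b
    rw [isBead_iff_extPart e (xiCharge e s) μ K, extCharge_xiCharge_succ]
  obtain ⟨h1, hpeak'⟩ := hf.peak_of_reduction hσ (hμ.extPart_succ he1 hs hcyl hP hK hα)
    (isBead_iff_extPart e s Λ K) hB' (j := i) (by omega) h0 h0p h0s
    hpeak
  obtain ⟨hres', hkey⟩ := content_and_key_of_extCharge (s := xiCharge e s) (C := C₀ + 1) (a := a)
    (b := α + 1) hi0 hie (by rw [extCharge_xiCharge_succ]; push_cast; exact hj)
  rw [compOf_succ, hcomp] at hres' hkey
  have hrow : ∀ b, 1 ≤ b → (((μ (rho l c)).part b : ℕ) : ℤ) =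
      extPart e (xiCharge e s) μ K (C₀ + 1) (extCharge e s C₀ - b) := by
    intro b hb
    rw [← extCharge_xiCharge_succ e s C₀, extPart_row _ _ _ _ _ hb, compOf_succ, hcomp]
  have hsucc := hμ.extPart_succ he1 hs hcyl hP hK hα C₀
  refine (goodAddable_iff hi0 hie _).2 ⟨⟨ha, ?_, ?_⟩, hres', ?_⟩
  · have := hrow a ha
    rw [hsucc, h0, if_neg (lt_irrefl _), h1] at this
    dsimp only
    omega
  · refine hprev.imp_right fun hprev => ?_
    have ha1 : a ≠ 1 := by
      rintro rfl
      rw [(Λ c).part_zero] at hprev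
      omega
    have h2 := hrow a ha
    have h3 := hrow (a - 1) (by omega)
    rw [show extCharge e s C₀ - (a - 1 : ℕ) = extCharge e s C₀ - a + 1 by omega, hsucc,
      if_pos h0s] at h3
    rw [hsucc, h0, if_neg (lt_irrefl _), h1] at h2
    dsimp only
    omega
  · rw [hkey]
    exact hpeak'

end FockCrystal
end
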